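/- arXiv:2101.09319 — 5 statements merged into one kernel-verified Lean document; each statement's English description precedes it below -/
import Mathlib

section
/- Let n₁, n₂ ≥ 1, let α₁ be a chord diagram of order n₁ and α₂ a chord diagram of order n₂, and let α be their join: the chord diagram of order n = n₁ + n₂ on ZMod (2n) whose restriction to the cyclic interval {0, …, 2n₁ − 1} is a copy of α₁ and whose restriction to {2n₁, …, 2n − 1} is a copy of α₂ (so α(i) = α₁(i) for 0 ≤ i < 2n₁, identifying points in the obvious way, and α(2n₁ + j) = 2n₁ + α₂(j) for 0 ≤ j < 2n₂). Then for every set A of chords of α, writing A₁ and A₂ for the corresponding sets of chords of α₁ and α₂, one has c_α(A) = c_{α₁}(A₁) + c_{α₂}(A₂) − 1. -/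
open scoped Classical

/-- The first point of `S` among `y + 1, y + 2, …` (equal to `y` if no such point exists). -/
noncomputable def firstAfter (n : ℕ) (S : Set (ZMod (2 * n))) (y : ZMod (2 * n)) : ZMod (2 * n) :=
  if h : ∃ k : ℕ, 0 < k ∧ y + (k : ZMod (2 * n)) ∈ S then y + (Nat.find h : ZMod (2 * n)) else y

/-- One step of the boundary permutation `π_A` of the endpoint set `S`:
`x ∈ S` goes to the first point of `S` among `α x + 1, α x + 2, …`. -/
def boundaryStep (n : ℕ) (α : Equiv.Perm (ZMod (2 * n))) (S : Set (ZMod (2 * n)))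
    (x y : ZMod (2 * n)) : Prop :=
  x ∈ S ∧ y = firstAfter n S (α x)

/-- `c(A)`: the number of orbits of `π_A` on the endpoint set `S`, with `c(∅) = 1`. -/
noncomputable def orbitCount (n : ℕ) (α : Equiv.Perm (ZMod (2 * n))) (S : Set (ZMod (2 * n))) : ℕ :=
  if S = ∅ then 1
  else ((fun x => {y | Relation.EqvGen (boundaryStep n α S) x y}) '' S).ncard

/-- The genus `g(α, A) = (2 + n − c(A) − c(Aᶜ))/2` of the partial dual relative to the
set of chords with endpoint set `S`. -/
noncomputable def pdGenus (n : ℕ) (α : Equiv.Perm (ZMod (2 * n))) (S : Set (ZMod (2 * n))) : ℕ :=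
  (2 + n - orbitCount n α S - orbitCount n α Sᶜ) / 2

/-- The chords `{x, α x}` and `{y, α y}` interlace: writing `α x = x + m`, exactly one of
`y, α y` lies in the cyclic interval `{x + k : 1 ≤ k ≤ m − 1}`. -/
def Interlaces (n : ℕ) (α : Equiv.Perm (ZMod (2 * n))) (x y : ZMod (2 * n)) : Prop :=
  Xor' (0 < (y - x).val ∧ (y - x).val < (α x - x).val)
       (0 < (α y - x).val ∧ (α y - x).val < (α x - x).val)

/-- The interlacement graph of `α`: vertices are the chords, adjacency is interlacement. -/
def interGraph (n : ℕ) (α : Equiv.Perm (ZMod (2 * n))) :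
    SimpleGraph {p : Sym2 (ZMod (2 * n)) // ∃ x, p = s(x, α x)} :=
  SimpleGraph.fromRel (fun c d => ∃ x y, c.1 = s(x, α x) ∧ d.1 = s(y, α y) ∧ Interlaces n α x y)

/-- The partial-dual genus polynomial `∂Γ_α(z) = Σ_{A ⊆ chords} z^{g(α,A)}`, the sum running
over the α-invariant endpoint sets. -/
noncomputable def pdPoly (n : ℕ) (hn : n ≠ 0) (α : Equiv.Perm (ZMod (2 * n))) : Polynomial ℕ :=
  haveI : NeZero (2 * n) := ⟨by omega⟩
  ∑ S : Finset (ZMod (2 * n)),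
    if (∀ x ∈ S, α x ∈ S) then Polynomial.X ^ pdGenus n α (↑S) else 0

/-- The face permutation `ρ ∘ α : x ↦ α x + 1`, whose orbits are the faces of the
one-vertex ribbon graph of `α`. -/
def faceMap (n : ℕ) (α : Equiv.Perm (ZMod (2 * n))) : Equiv.Perm (ZMod (2 * n)) :=
  α.trans (Equiv.addRight 1)

/-- The face (orbit of `ρ ∘ α`) containing a point `z`. -/
def faceOrbit (n : ℕ) (α : Equiv.Perm (ZMod (2 * n))) (z : ZMod (2 * n)) : Set (ZMod (2 * n)) :=
  {w | (faceMap n α).SameCycle z w}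

/-- The number of faces of the one-vertex ribbon graph of `α`:
the number of orbits of `ρ ∘ α`. -/
noncomputable def numFaces (n : ℕ) (α : Equiv.Perm (ZMod (2 * n))) : ℕ :=
  (Set.range (faceOrbit n α)).ncard

/-- The chord diagram `B_n`: the involution `x ↦ x + n` of `ZMod (2n)`, all of whose
chords are pairwise interlacing. -/
def bn (n : ℕ) : Equiv.Perm (ZMod (2 * n)) :=
  Equiv.addRight (n : ZMod (2 * n))

def NextPt (T : Set ℕ) (y z : ℕ) : Prop :=
  z ∈ T ∧ ((y < z ∧ ∀ w ∈ T, w ≤ y ∨ z ≤ w) ∨ (∀ w ∈ T, w ≤ y ∧ z ≤ w))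

def stepN (T : Set ℕ) (a : ℕ → ℕ) (x y : ℕ) : Prop := x ∈ T ∧ NextPt T (a x) y

noncomputable def cN (T : Set ℕ) (a : ℕ → ℕ) : ℕ :=
  if T = ∅ then 1 else ((fun x => {y | Relation.EqvGen (stepN T a) x y}) '' T).ncard

theorem NextPt.unique {T : Set ℕ} {y z z' : ℕ} (h : NextPt T y z) (h' : NextPt T y z') :
    z = z' := by
  obtain ⟨hz, h⟩ := h
  obtain ⟨hz', h'⟩ := h'
  rcases h with ⟨h1, h2⟩ | h2 <;> rcases h' with ⟨h3, h4⟩ | h4 <;>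
    have := h2 z' hz' <;> have := h4 z hz <;> omega

theorem NextPt.inj {T : Set ℕ} {y y' z : ℕ} (hy : y ∈ T) (hy' : y' ∈ T)
    (h : NextPt T y z) (h' : NextPt T y' z) : y = y' := by
  obtain ⟨hz, h⟩ := h
  obtain ⟨hz', h'⟩ := h'
  rcases h with ⟨h1, h2⟩ | h2 <;> rcases h' with ⟨h3, h4⟩ | h4 <;>
    have := h2 y' hy' <;> have := h4 y hy <;> omega

theorem NextPt.exists {T : Set ℕ} (hT : T.Nonempty) (y : ℕ) : ∃ z, NextPt T y z := by
  by_cases h : ∃ w, w ∈ T ∧ y < w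
  · refine ⟨Nat.find h, (Nat.find_spec h).1, Or.inl ⟨(Nat.find_spec h).2, fun w hw => ?_⟩⟩
    by_contra! hc
    exact Nat.find_min h hc.2 ⟨hw, hc.1⟩
  · push Not at h
    exact ⟨sInf T, Nat.sInf_mem hT, Or.inr fun w hw => ⟨h w hw, Nat.sInf_le hw⟩⟩

theorem class_eq_iff {X : Type*} (r : X → X → Prop) (x y : X) :
    ({z | Relation.EqvGen r x z} = {z | Relation.EqvGen r y z}) ↔ Relation.EqvGen r x y := by
  constructor
  · intro h
    have : y ∈ {z | Relation.EqvGen r y z} := Relation.EqvGen.refl y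
    rw [← h] at this
    exact this
  · intro h
    ext z
    exact ⟨fun hz => (h.symm).trans _ _ _ hz, fun hz => h.trans _ _ _ hz⟩

theorem ncard_label {X Y Z : Type*} (S : Set X) (f : X → Y) (g : X → Z)
    (h : ∀ x ∈ S, ∀ y ∈ S, f x = f y ↔ g x = g y) : (f '' S).ncard = (g '' S).ncard := by
  refine Set.ncard_congr (fun y hy => g hy.choose) ?_ ?_ ?_
  · intro y hy
    exact ⟨_, hy.choose_spec.1, rfl⟩
  · intro y y' hy hy' he
    have := (h _ hy.choose_spec.1 _ hy'.choose_spec.1).2 he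
    rw [hy.choose_spec.2, hy'.choose_spec.2] at this
    exact this
  · rintro _ ⟨x, hx, rfl⟩
    have hy : f x ∈ f '' S := ⟨x, hx, rfl⟩
    exact ⟨f x, hy, (h _ hy.choose_spec.1 _ hx).1 hy.choose_spec.2⟩

theorem eqvGen_map {X Y : Type*} {r : X → X → Prop} {s : Y → Y → Prop} (e : X → Y)
    (h : ∀ x y, r x y → Relation.EqvGen s (e x) (e y)) {x y : X} (hxy : Relation.EqvGen r x y) :
    Relation.EqvGen s (e x) (e y) := by
  induction hxy with
  | rel x y hr => exact h x y hr
  | refl x => exact .refl _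
  | symm x y _ ih => exact ih.symm
  | trans x y z _ _ ih1 ih2 => exact ih1.trans _ _ _ ih2

theorem eqvGen_inv {X Y : Type*} {r : X → X → Prop} (g : X → Y)
    (h : ∀ x y, r x y → g x = g y) {x y : X} (hxy : Relation.EqvGen r x y) : g x = g y := by
  induction hxy with
  | rel x y hr => exact h x y hr
  | refl x => rfl
  | symm x y _ ih => exact ih.symm
  | trans x y z _ _ ih1 ih2 => exact ih1.trans ih2

theorem firstAfter_next (n : ℕ) (hn : 1 ≤ n) (S : Set (ZMod (2 * n))) (hS : S.Nonempty)
    (y : ZMod (2 * n)) : firstAfter n S y ∈ S ∧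
      (((y.val < (firstAfter n S y).val ∧
        ∀ w ∈ S, w.val ≤ y.val ∨ (firstAfter n S y).val ≤ w.val)) ∨
      (∀ w ∈ S, w.val ≤ y.val ∧ (firstAfter n S y).val ≤ w.val)) := by
  haveI : NeZero (2 * n) := ⟨by omega⟩
  have key : ∀ w : ZMod (2 * n), y + ((w.val + 2 * n - y.val : ℕ) : ZMod (2 * n)) = w := by
    intro w
    have := y.val_lt
    rw [Nat.cast_sub (by omega), Nat.cast_add, ZMod.natCast_zmod_val, ZMod.natCast_zmod_val,
      ZMod.natCast_self]
    ring
  have key2 : ∀ w : ZMod (2 * n), y.val ≤ w.val →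
      y + ((w.val - y.val : ℕ) : ZMod (2 * n)) = w := by
    intro w hw
    rw [Nat.cast_sub hw, ZMod.natCast_zmod_val, ZMod.natCast_zmod_val]
    ring
  have h : ∃ k : ℕ, 0 < k ∧ y + (k : ZMod (2 * n)) ∈ S := by
    obtain ⟨w, hw⟩ := hS
    have := y.val_lt
    exact ⟨w.val + 2 * n - y.val, by omega, by rw [key]; exact hw⟩
  have hf : firstAfter n S y = y + (Nat.find h : ZMod (2 * n)) := by
    unfold firstAfter
    rw [dif_pos h]
  have hle1 : ∀ w ∈ S, Nat.find h ≤ w.val + 2 * n - y.val := fun w hw =>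
    Nat.find_min' h ⟨by have := y.val_lt; omega, by rw [key]; exact hw⟩
  have hle2 : ∀ w ∈ S, y.val < w.val → Nat.find h ≤ w.val - y.val := fun w hw hlt =>
    Nat.find_min' h ⟨by omega, by rw [key2 w hlt.le]; exact hw⟩
  obtain ⟨hpos, hmem⟩ := Nat.find_spec h
  rw [hf]
  refine ⟨hmem, ?_⟩
  have hv : (y + (Nat.find h : ZMod (2 * n))).val = (y.val + Nat.find h) % (2 * n) := by
    rw [ZMod.val_add, ZMod.val_natCast, Nat.add_mod_mod]
  rw [hv]
  generalize Nat.find h = k at *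
  have hy := y.val_lt
  by_cases hk : y.val + k < 2 * n
  · left
    rw [Nat.mod_eq_of_lt hk]
    refine ⟨by omega, fun w hw => ?_⟩
    by_cases hwy : y.val < w.val
    · have := hle2 w hw hwy; omega
    · omega
  · right
    obtain ⟨w0, hw0⟩ := hS
    have h0 := hle1 w0 hw0
    have h0' := w0.val_lt
    rw [Nat.mod_eq_sub_mod (by omega), Nat.mod_eq_of_lt (by omega)]
    intro w hw
    have := hle1 w hw
    have hw' := w.val_lt
    by_cases hwy : y.val < w.val
    · have := hle2 w hw hwy; omega
    · omega

theorem orbitCount_eq (n : ℕ) (hn : 1 ≤ n) (α : Equiv.Perm (ZMod (2 * n)))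
    (S : Set (ZMod (2 * n))) (k : ℕ) (a : ℕ → ℕ)
    (ha : ∀ x ∈ S, a (x.val + k) = (α x).val + k) :
    orbitCount n α S = cN ((fun x : ZMod (2 * n) => x.val + k) '' S) a := by
  haveI : NeZero (2 * n) := ⟨by omega⟩
  unfold orbitCount cN
  simp only [Set.image_eq_empty]
  split_ifs with hS
  · rfl
  have hS : S.Nonempty := Set.nonempty_iff_ne_empty.2 hS
  set e : ZMod (2 * n) → ℕ := fun x => x.val + k with he
  have einj : Function.Injective e := by
    intro x y hxy
    exact ZMod.val_injective _ (by simpa [he] using hxy)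
  have hstep : ∀ x ∈ S, NextPt (e '' S) (a (e x)) (e (firstAfter n S (α x))) := by
    intro x hx
    obtain ⟨h1, h2⟩ := firstAfter_next n hn S hS (α x)
    refine ⟨⟨_, h1, rfl⟩, ?_⟩
    have : a (e x) = (α x).val + k := ha x hx
    rw [this]
    simp only [Set.forall_mem_image, he]
    rcases h2 with ⟨h2, h3⟩ | h3
    · left
      refine ⟨by omega, fun w hw => ?_⟩
      have := h3 w hw; omega
    · right
      intro w hw
      have := h3 w hw; omega
  rw [Set.image_image]
  apply ncard_label
  intro x hx y hy
  rw [class_eq_iff, class_eq_iff]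
  constructor
  · apply eqvGen_map
    rintro x y ⟨hx, rfl⟩
    exact .rel _ _ ⟨⟨x, hx, rfl⟩, hstep x hx⟩
  · intro h
    have := eqvGen_map (s := boundaryStep n α S) (Function.invFun e) ?_ h
    · rwa [Function.leftInverse_invFun einj, Function.leftInverse_invFun einj] at this
    · rintro _ y ⟨⟨x, hx, rfl⟩, hn⟩
      rw [hn.unique (hstep x hx), Function.leftInverse_invFun einj,
        Function.leftInverse_invFun einj]
      exact .rel _ _ ⟨hx, rfl⟩

theorem cN_union (T₁ T₂ : Set ℕ) (hf₁ : T₁.Finite) (hf₂ : T₂.Finite)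
    (hlt : ∀ x ∈ T₁, ∀ y ∈ T₂, x < y) (a : ℕ → ℕ)
    (ha₁ : ∀ x ∈ T₁, a x ∈ T₁) (ha₂ : ∀ x ∈ T₂, a x ∈ T₂)
    (hi₁ : ∀ x ∈ T₁, a (a x) = x) :
    cN (T₁ ∪ T₂) a = cN T₁ a + cN T₂ a - 1 := by
  rcases T₁.eq_empty_or_nonempty with rfl | hne₁
  · simp [cN]
  rcases T₂.eq_empty_or_nonempty with rfl | hne₂
  · simp [cN]
  have hdis : ∀ x ∈ T₂, x ∉ T₁ := fun x h2 h1 => lt_irrefl _ (hlt x h1 x h2)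
  set m₁ := sInf T₁ with hm₁
  set m₂ := sInf T₂ with hm₂
  have hm₁T : m₁ ∈ T₁ := Nat.sInf_mem hne₁
  have hm₂T : m₂ ∈ T₂ := Nat.sInf_mem hne₂
  have hm₁le : ∀ x ∈ T₁, m₁ ≤ x := fun x hx => Nat.sInf_le hx
  have hm₂le : ∀ x ∈ T₂, m₂ ≤ x := fun x hx => Nat.sInf_le hx
  -- relation of the successors
  have s₁ : ∀ x ∈ T₁, ∀ y, NextPt T₁ x y →
      NextPt (T₁ ∪ T₂) x y ∨ (y = m₁ ∧ (∀ w ∈ T₁, w ≤ x) ∧ NextPt (T₁ ∪ T₂) x m₂) := by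
    rintro x hx y ⟨hy, ⟨h1, h2⟩ | h2⟩
    · left
      refine ⟨Or.inl hy, Or.inl ⟨h1, ?_⟩⟩
      rintro w (hw | hw)
      · exact h2 w hw
      · exact Or.inr (hlt y hy w hw).le
    · right
      refine ⟨le_antisymm (h2 m₁ hm₁T).2 (hm₁le y hy), fun w hw => (h2 w hw).1,
        Or.inr hm₂T, Or.inl ⟨hlt x hx _ hm₂T, ?_⟩⟩
      rintro w (hw | hw)
      · exact Or.inl (h2 w hw).1
      · exact Or.inr (hm₂le w hw)
  have s₂ : ∀ x ∈ T₂, ∀ y, NextPt T₂ x y →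
      NextPt (T₁ ∪ T₂) x y ∨ (y = m₂ ∧ NextPt (T₁ ∪ T₂) x m₁) := by
    rintro x hx y ⟨hy, ⟨h1, h2⟩ | h2⟩
    · left
      refine ⟨Or.inr hy, Or.inl ⟨h1, ?_⟩⟩
      rintro w (hw | hw)
      · exact Or.inl (hlt w hw x hx).le
      · exact h2 w hw
    · right
      refine ⟨le_antisymm (h2 m₂ hm₂T).2 (hm₂le y hy), Or.inl hm₁T, Or.inr ?_⟩
      rintro w (hw | hw)
      · exact ⟨(hlt w hw x hx).le, hm₁le w hw⟩
      · exact ⟨(h2 w hw).1, (hlt _ hm₁T w hw).le⟩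
  set R := Relation.EqvGen (stepN (T₁ ∪ T₂) a) with hR
  choose f hf using NextPt.exists hne₁
  have hmm : R m₁ m₂ := by
    by_contra hno
    set D : Set ℕ := {x | x ∈ T₁ ∧ ¬ R x m₂} with hD
    have hmaps : ∀ x ∈ D, f (a x) ∈ D ∧ NextPt (T₁ ∪ T₂) (a x) (f (a x)) := by
      rintro x ⟨hx, hxR⟩
      rcases s₁ (a x) (ha₁ x hx) _ (hf (a x)) with h | ⟨_, _, h⟩
      · refine ⟨⟨(hf (a x)).1, fun hc => hxR ?_⟩, h⟩
        exact (Relation.EqvGen.rel _ _ ⟨Or.inl hx, h⟩).trans _ _ _ hc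
      · exact absurd (.rel _ _ ⟨Or.inl hx, h⟩) hxR
    have hinj : Set.InjOn (fun x => f (a x)) D := by
      intro x hx y hy hxy
      have h1 := hf (a x)
      have h2 := hf (a y)
      simp only at hxy
      rw [← hxy] at h2
      have := h1.inj (ha₁ x hx.1) (ha₁ y hy.1) h2
      rw [← hi₁ x hx.1, ← hi₁ y hy.1, this]
    have hDf : D.Finite := hf₁.subset fun x hx => hx.1
    have himg : (fun x => f (a x)) '' D = D := by
      apply Set.eq_of_subset_of_ncard_le _ _ hDf
      · rintro _ ⟨x, hx, rfl⟩
        exact (hmaps x hx).1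
      · rw [Set.ncard_image_of_injOn hinj]
    have hmD : m₁ ∈ D := ⟨hm₁T, hno⟩
    rw [← himg] at hmD
    obtain ⟨x, hx, hxm⟩ := hmD
    have h := (hmaps x hx).2
    simp only at hxm
    rw [hxm] at h
    obtain ⟨_, ⟨h1, _⟩ | h2⟩ := h
    · have := hm₁le _ (ha₁ x hx.1); omega
    · have := (h2 m₂ (Or.inr hm₂T)).1
      have := hlt _ (ha₁ x hx.1) _ hm₂T
      omega
  have l₁ : ∀ x y, Relation.EqvGen (stepN T₁ a) x y → R x y := by
    intro x y h
    refine eqvGen_map id ?_ h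
    rintro x y ⟨hx, h⟩
    rcases s₁ _ (ha₁ x hx) _ h with h | ⟨rfl, _, h⟩
    · exact .rel _ _ ⟨Or.inl hx, h⟩
    · exact (Relation.EqvGen.rel _ _ ⟨Or.inl hx, h⟩).trans _ _ _ hmm.symm
  have l₂ : ∀ x y, Relation.EqvGen (stepN T₂ a) x y → R x y := by
    intro x y h
    refine eqvGen_map id ?_ h
    rintro x y ⟨hx, h⟩
    rcases s₂ _ (ha₂ x hx) _ h with h' | ⟨rfl, h'⟩
    · exact .rel _ _ ⟨Or.inr hx, h'⟩
    · exact (Relation.EqvGen.rel _ _ ⟨Or.inr hx, h'⟩).trans _ _ _ hmm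
  set c₁ : ℕ → Set ℕ := fun x => {y | Relation.EqvGen (stepN T₁ a) x y} with hc₁
  set c₂ : ℕ → Set ℕ := fun x => {y | Relation.EqvGen (stepN T₂ a) x y} with hc₂
  have e₁ : ∀ x y, c₁ x = c₁ y ↔ Relation.EqvGen (stepN T₁ a) x y := class_eq_iff _
  have e₂ : ∀ x y, c₂ x = c₂ y ↔ Relation.EqvGen (stepN T₂ a) x y := class_eq_iff _
  set g : ℕ → Set ℕ ⊕ Set ℕ := fun x => if x ∈ T₁ then Sum.inl (c₁ x) else
    if c₂ x = c₂ m₂ then Sum.inl (c₁ m₁) else Sum.inr (c₂ x) with hg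
  have g₁ : ∀ x ∈ T₁, g x = Sum.inl (c₁ x) := fun x hx => by simp only [hg, if_pos hx]
  have g₂ : ∀ x ∈ T₂, g x = if c₂ x = c₂ m₂ then Sum.inl (c₁ m₁) else Sum.inr (c₂ x) :=
    fun x hx => by simp only [hg, if_neg (hdis x hx)]
  have gm : g m₂ = g m₁ := by rw [g₁ _ hm₁T, g₂ _ hm₂T, if_pos rfl]
  have ginv : ∀ x y, R x y → g x = g y := by
    intro x y h
    refine eqvGen_inv g ?_ h
    rintro x y ⟨hx | hx, h⟩
    · obtain ⟨z, hz⟩ := NextPt.exists hne₁ (a x)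
      have hxz : g x = g z := by
        rw [g₁ x hx, g₁ z hz.1, (e₁ _ _).2 (.rel _ _ ⟨hx, hz⟩)]
      rcases s₁ _ (ha₁ x hx) _ hz with h' | ⟨rfl, _, h'⟩
      · rw [h.unique h', hxz]
      · rw [h.unique h', hxz, gm]
    · obtain ⟨z, hz⟩ := NextPt.exists hne₂ (a x)
      have hxz : g x = g z := by
        rw [g₂ x hx, g₂ z hz.1, (e₂ _ _).2 (.rel _ _ ⟨hx, hz⟩)]
      rcases s₂ _ (ha₂ x hx) _ hz with h' | ⟨rfl, h'⟩
      · rw [h.unique h', hxz]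
      · rw [h.unique h', hxz, gm]
  -- every point is `R`-equivalent according to its label
  have q₁ : ∀ x ∈ T₁ ∪ T₂, ∀ s, g x = Sum.inl s → ∃ y, c₁ y = s ∧ R x y := by
    rintro x (hx | hx) s hs
    · rw [g₁ x hx] at hs
      exact ⟨x, Sum.inl_injective hs, .refl _⟩
    · rw [g₂ x hx] at hs
      split_ifs at hs with h
      exact ⟨m₁, Sum.inl_injective hs, (l₂ _ _ ((e₂ _ _).1 h)).trans _ _ _ hmm.symm⟩
  have q₂ : ∀ x ∈ T₁ ∪ T₂, ∀ s, g x = Sum.inr s → c₂ x = s := by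
    rintro x (hx | hx) s hs
    · rw [g₁ x hx] at hs; cases hs
    · rw [g₂ x hx] at hs
      split_ifs at hs with h
      exact Sum.inr_injective hs
  have hcount : cN (T₁ ∪ T₂) a = (g '' (T₁ ∪ T₂)).ncard := by
    unfold cN
    rw [if_neg (hne₁.mono Set.subset_union_left).ne_empty]
    apply ncard_label
    intro x hx y hy
    rw [class_eq_iff]
    refine ⟨ginv x y, fun h => ?_⟩
    rcases hgx : g x with s | s
    · obtain ⟨u, hu, hxu⟩ := q₁ x hx s hgx
      obtain ⟨v, hv, hyv⟩ := q₁ y hy s (h ▸ hgx)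
      exact (hxu.trans _ _ _ (l₁ _ _ ((e₁ _ _).1 (hu.trans hv.symm)))).trans _ _ _ hyv.symm
    · exact l₂ _ _ ((e₂ _ _).1 ((q₂ x hx s hgx).trans (q₂ y hy s (h ▸ hgx)).symm))
  have himg : g '' (T₁ ∪ T₂) = Sum.inl '' (c₁ '' T₁) ∪ Sum.inr '' (c₂ '' T₂ \ {c₂ m₂}) := by
    ext s
    constructor
    · rintro ⟨x, hx | hx, rfl⟩
      · rw [g₁ x hx]
        exact Or.inl ⟨_, ⟨x, hx, rfl⟩, rfl⟩
      · rw [g₂ x hx]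
        split_ifs with h
        · exact Or.inl ⟨_, ⟨m₁, hm₁T, rfl⟩, rfl⟩
        · exact Or.inr ⟨_, ⟨⟨x, hx, rfl⟩, h⟩, rfl⟩
    · rintro (⟨_, ⟨x, hx, rfl⟩, rfl⟩ | ⟨_, ⟨⟨x, hx, rfl⟩, h⟩, rfl⟩)
      · exact ⟨x, Or.inl hx, g₁ x hx⟩
      · exact ⟨x, Or.inr hx, by rw [g₂ x hx, if_neg (show ¬ c₂ x = c₂ m₂ from fun hh => h hh)]⟩
  rw [hcount, himg, Set.ncard_union_eq ?_ ((hf₁.image _).image _)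
    (((hf₂.image _).subset Set.diff_subset).image _),
    Set.ncard_image_of_injective _ Sum.inl_injective,
    Set.ncard_image_of_injective _ Sum.inr_injective,
    Set.ncard_sdiff_singleton_of_mem (Set.mem_image_of_mem c₂ hm₂T)]
  · have hpos : 0 < (c₂ '' T₂).ncard := (Set.ncard_pos (hf₂.image _)).2 (hne₂.image _)
    unfold cN
    rw [if_neg hne₁.ne_empty, if_neg hne₂.ne_empty]
    change _ = (c₁ '' T₁).ncard + (c₂ '' T₂).ncard - 1
    omega
  · rw [Set.disjoint_left]
    rintro _ ⟨_, _, rfl⟩ ⟨_, _, h⟩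
    cases h

/-- For the join `α` of two chord diagrams `α₁`, `α₂` (the first occupying the cyclic
interval `{0, …, 2n₁ − 1}` and the second `{2n₁, …, 2n − 1}`), the boundary-component
count is additive up to 1: `c_α(A) = c_{α₁}(A₁) + c_{α₂}(A₂) − 1`. -/
theorem join_orbitCount (n₁ n₂ : ℕ) (h₁ : 1 ≤ n₁) (h₂ : 1 ≤ n₂)
    (α₁ : Equiv.Perm (ZMod (2 * n₁))) (α₂ : Equiv.Perm (ZMod (2 * n₂)))
    (α : Equiv.Perm (ZMod (2 * (n₁ + n₂))))
    (hinv₁ : ∀ x, α₁ (α₁ x) = x) (hfree₁ : ∀ x, α₁ x ≠ x)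
    (hinv₂ : ∀ x, α₂ (α₂ x) = x) (hfree₂ : ∀ x, α₂ x ≠ x)
    (hjoin₁ : ∀ i : ℕ, i < 2 * n₁ →
      α ((i : ℕ) : ZMod (2 * (n₁ + n₂))) =
        (((α₁ ((i : ℕ) : ZMod (2 * n₁))).val : ℕ) : ZMod (2 * (n₁ + n₂))))
    (hjoin₂ : ∀ j : ℕ, j < 2 * n₂ →
      α ((2 * n₁ + j : ℕ) : ZMod (2 * (n₁ + n₂))) =
        ((2 * n₁ + (α₂ ((j : ℕ) : ZMod (2 * n₂))).val : ℕ) : ZMod (2 * (n₁ + n₂))))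
    (S : Set (ZMod (2 * (n₁ + n₂)))) (hS : ∀ x ∈ S, α x ∈ S) :
    orbitCount (n₁ + n₂) α S =
      orbitCount n₁ α₁ {x : ZMod (2 * n₁) | ((x.val : ℕ) : ZMod (2 * (n₁ + n₂))) ∈ S} +
      orbitCount n₂ α₂ {x : ZMod (2 * n₂) | ((2 * n₁ + x.val : ℕ) : ZMod (2 * (n₁ + n₂))) ∈ S}
      - 1 := by
  haveI : NeZero (2 * n₁) := ⟨by omega⟩
  haveI : NeZero (2 * n₂) := ⟨by omega⟩
  haveI : NeZero (2 * (n₁ + n₂)) := ⟨by omega⟩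
  set a : ℕ → ℕ := fun i => (α (i : ZMod (2 * (n₁ + n₂)))).val with ha
  have a₁ : ∀ x : ZMod (2 * n₁), a x.val = (α₁ x).val := by
    intro x
    have h := hjoin₁ x.val x.val_lt
    have := (α₁ x).val_lt
    rw [ZMod.natCast_zmod_val] at h
    simp only [ha]
    rw [h, ZMod.val_natCast, Nat.mod_eq_of_lt (by omega)]
  have a₂ : ∀ x : ZMod (2 * n₂), a (2 * n₁ + x.val) = 2 * n₁ + (α₂ x).val := by
    intro x
    have h := hjoin₂ x.val x.val_lt
    have := (α₂ x).val_lt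
    rw [ZMod.natCast_zmod_val] at h
    simp only [ha]
    rw [h, ZMod.val_natCast, Nat.mod_eq_of_lt (by omega)]
  set S₁ := {x : ZMod (2 * n₁) | ((x.val : ℕ) : ZMod (2 * (n₁ + n₂))) ∈ S} with hS₁
  set S₂ := {x : ZMod (2 * n₂) | ((2 * n₁ + x.val : ℕ) : ZMod (2 * (n₁ + n₂))) ∈ S} with hS₂
  have cl₁ : ∀ x ∈ S₁, α₁ x ∈ S₁ := by
    intro x hx
    have h := hjoin₁ x.val x.val_lt
    rw [ZMod.natCast_zmod_val] at h
    have h' := hS _ hx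
    rw [h] at h'
    exact h'
  have cl₂ : ∀ x ∈ S₂, α₂ x ∈ S₂ := by
    intro x hx
    have h := hjoin₂ x.val x.val_lt
    rw [ZMod.natCast_zmod_val] at h
    have h' := hS _ hx
    rw [h] at h'
    exact h'
  rw [orbitCount_eq (n₁ + n₂) (by omega) α S 0 a (by intro x _; simp [ha]),
    orbitCount_eq n₁ h₁ α₁ S₁ 0 a (by intro x _; simpa using a₁ x),
    orbitCount_eq n₂ h₂ α₂ S₂ (2 * n₁) a
      (by intro x _; rw [add_comm, a₂ x, add_comm])]
  rw [← cN_union]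
  · congr 1
    ext i
    constructor
    · rintro ⟨x, hx, rfl⟩
      have hxl := x.val_lt
      by_cases h : x.val < 2 * n₁
      · left
        refine ⟨(x.val : ZMod (2 * n₁)), ?_, ?_⟩
        · simp only [hS₁, Set.mem_setOf_eq]
          rw [ZMod.val_natCast, Nat.mod_eq_of_lt h, ZMod.natCast_zmod_val]
          exact hx
        · simp only
          rw [ZMod.val_natCast, Nat.mod_eq_of_lt h]
      · right
        refine ⟨((x.val - 2 * n₁ : ℕ) : ZMod (2 * n₂)), ?_, ?_⟩
        · simp only [hS₂, Set.mem_setOf_eq]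
          rw [ZMod.val_natCast, Nat.mod_eq_of_lt (by omega), Nat.add_sub_cancel' (by omega),
            ZMod.natCast_zmod_val]
          exact hx
        · simp only
          rw [ZMod.val_natCast, Nat.mod_eq_of_lt (by omega)]
          omega
    · rintro (⟨x, hx, rfl⟩ | ⟨x, hx, rfl⟩)
      · have := x.val_lt
        exact ⟨_, hx, by simp only; rw [ZMod.val_natCast, Nat.mod_eq_of_lt (by omega)]⟩
      · have := x.val_lt
        exact ⟨_, hx, by simp only; rw [ZMod.val_natCast, Nat.mod_eq_of_lt (by omega)]; omega⟩
  · exact (Set.toFinite _).image _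
  · exact (Set.toFinite _).image _
  · rintro _ ⟨x, _, rfl⟩ _ ⟨y, _, rfl⟩
    have := x.val_lt
    simp only
    omega
  · rintro _ ⟨x, hx, rfl⟩
    exact ⟨_, cl₁ x hx, (a₁ x).symm⟩
  · rintro _ ⟨x, hx, rfl⟩
    refine ⟨_, cl₂ x hx, ?_⟩
    simp only
    rw [add_comm x.val, a₂ x, add_comm]
  · rintro _ ⟨x, hx, rfl⟩
    simp only [add_zero]
    rw [a₁, a₁, hinv₁]
end

section
/- Let n₁, n₂ ≥ 1, let α₁ be a chord diagram of order n₁ and α₂ a chord diagram of order n₂, and let α be their join: the chord diagram of order n = n₁ + n₂ on ZMod (2n) with α(i) = α₁(i) for 0 ≤ i < 2n₁ (identifying points in the obvious way) and α(2n₁ + j) = 2n₁ + α₂(j) for 0 ≤ j < 2n₂. Then for every set A of chords of α, with A₁, A₂ the corresponding sets of chords of α₁, α₂, one has g(α, A) = g(α₁, A₁) + g(α₂, A₂); consequently the partial-dual genus polynomial is multiplicative with respect to the join: ∂Γ_α(z) = ∂Γ_{α₁}(z) · ∂Γ_{α₂}(z). -/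
open scoped Classical

noncomputable def numOrb {T : Type*} (f : T → T) : ℕ := Nat.card (Quot (fun x y => y = f x))

def ocl {T : Type*} (f : T → T) (a : T) : Quot (fun x y => y = f x) := Quot.mk _ a

lemma ocl_step {T : Type*} (f : T → T) (a : T) : ocl f (f a) = ocl f a :=
  (Quot.sound (r := fun x y => y = f x) (a := a) (b := f a) rfl).symm

lemma ocl_pow {T : Type*} (σ : Equiv.Perm T) (a : T) (i : ℕ) : ocl σ ((σ ^ i) a) = ocl σ a := by
  induction i with
  | zero => simp
  | succ i ih => rw [pow_succ', Equiv.Perm.mul_apply, ocl_step, ih]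

lemma ocl_exists_pow {T : Type*} [Finite T] (σ : Equiv.Perm T) {a b : T}
    (h : ocl σ a = ocl σ b) : ∃ k : ℕ, (σ ^ k) a = b := by
  have h' : σ.SameCycle a b := by
    have := Quot.eqvGen_exact h
    induction this with
    | rel x y h0 => exact ⟨1, by simp [h0]⟩
    | refl x => exact Equiv.Perm.SameCycle.refl _ _
    | symm x y _ ih => exact (ih (Quot.eqvGen_sound (by assumption))).symm
    | trans x y z h1 h2 ih1 ih2 =>
      exact (ih1 (Quot.eqvGen_sound h1)).trans (ih2 (Quot.eqvGen_sound h2))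
  obtain ⟨k, hk⟩ := h'.exists_nat_pow_eq
  exact ⟨k, hk⟩

lemma numOrb_merge {T : Type*} [Finite T] [DecidableEq T] (σ : Equiv.Perm T) (x y : T)
    (hxy : ocl σ x ≠ ocl σ y) : numOrb (σ * Equiv.swap x y) + 1 = numOrb σ := by
  set τ := σ * Equiv.swap x y with hτ
  have hτo : ∀ z, z ≠ x → z ≠ y → τ z = σ z := by
    intro z h1 h2
    simp [hτ, Equiv.swap_apply_of_ne_of_ne h1 h2]
  have hτx : τ x = σ y := by simp [hτ]
  have hτy : τ y = σ x := by simp [hτ]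
  have hA : ocl τ x = ocl τ y := by
    have hex : ∃ k : ℕ, 0 < k ∧ (σ ^ k) x = x :=
      ⟨orderOf σ, orderOf_pos σ, by simp [pow_orderOf_eq_one]⟩
    obtain ⟨hk0, hk⟩ := Nat.find_spec hex
    have key : ∀ i, 1 ≤ i → i ≤ Nat.find hex → ocl τ ((σ ^ i) x) = ocl τ y := by
      intro i hi
      induction i, hi using Nat.le_induction with
      | base => intro _; rw [pow_one, ← hτy, ocl_step]
      | succ i hi ih =>
        intro hik
        rw [← ih (by omega), pow_succ', Equiv.Perm.mul_apply, ← hτo, ocl_step]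
        · intro h
          exact Nat.find_min hex (m := i) (by omega) ⟨by omega, h⟩
        · intro h
          exact hxy (by rw [← h, ocl_pow])
    have := key _ hk0 le_rfl
    rwa [hk] at this
  have hB : ∀ z, ocl τ (σ z) = ocl τ z := by
    intro z
    by_cases h1 : z = x
    · subst h1; rw [← hτy, ocl_step, hA]
    by_cases h2 : z = y
    · subst h2; rw [← hτx, ocl_step, hA]
    rw [← hτo z h1 h2, ocl_step]
  let g0 : T → {q : Quot (fun x y => y = σ x) // q ≠ ocl σ y} := fun z =>
    if h : ocl σ z = ocl σ y then ⟨ocl σ x, hxy⟩ else ⟨ocl σ z, h⟩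
  have hg0 : ∀ a, g0 (σ a) = g0 a := by
    intro a; simp only [g0, ocl_step]
  have hg0xy : g0 x = g0 y := by
    simp [g0, hxy]
  have hg : ∀ a, g0 (τ a) = g0 a := by
    intro z
    by_cases h1 : z = x
    · subst h1; rw [hτx, hg0, hg0xy]
    by_cases h2 : z = y
    · subst h2; rw [hτy, hg0, hg0xy]
    rw [hτo z h1 h2, hg0]
  let g : Quot (fun x y => y = τ x) → {q : Quot (fun x y => y = σ x) // q ≠ ocl σ y} :=
    Quot.lift g0 (by rintro a b rfl; exact (hg a).symm)
  let f : Quot (fun x y => y = σ x) → Quot (fun x y => y = τ x) :=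
    Quot.lift (ocl τ) (by rintro a b rfl; exact (hB a).symm)
  have e : Quot (fun x y => y = τ x) ≃ {q : Quot (fun x y => y = σ x) // q ≠ ocl σ y} :=
    { toFun := g
      invFun := fun q => f q.1
      left_inv := by
        rintro ⟨a⟩
        change f (g0 a).1 = ocl τ a
        by_cases h : ocl σ a = ocl σ y
        · have h3 : (g0 a).1 = ocl σ x := by simp [g0, h]
          rw [h3]
          have h2 := congrArg f h
          change ocl τ a = ocl τ y at h2
          change ocl τ x = _
          rw [hA, h2]
        · have h3 : (g0 a).1 = ocl σ a := by simp [g0, h]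
          rw [h3]; rfl
      right_inv := by
        rintro ⟨⟨a⟩, h⟩
        change g0 a = _
        have h' : ocl σ a ≠ ocl σ y := h
        simp only [g0, h', dite_false]
        rfl }
  unfold numOrb
  rw [Nat.card_congr e]
  have : Finite (Quot (fun x y => y = σ x)) := Quot.finite _
  have : Fintype (Quot (fun x y => y = σ x)) := Fintype.ofFinite _
  rw [Nat.card_eq_fintype_card, Nat.card_eq_fintype_card, Fintype.card_subtype_compl,
    Fintype.card_subtype_eq]
  have : 0 < Fintype.card (Quot (fun x y => y = σ x)) := Fintype.card_pos_iff.2 ⟨ocl σ y⟩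
  omega

lemma ocl_split {T : Type*} [Finite T] (σ : Equiv.Perm T) (x y : T) (hne : x ≠ y)
    (hxy : ocl σ x = ocl σ y) :
    ocl (σ * Equiv.swap x y : Equiv.Perm T) x ≠ ocl (σ * Equiv.swap x y : Equiv.Perm T) y := by
  set τ := σ * Equiv.swap x y with hτ
  have hτo : ∀ z, z ≠ x → z ≠ y → τ z = σ z := by
    intro z h1 h2
    simp [hτ, Equiv.swap_apply_of_ne_of_ne h1 h2]
  have hτy : τ y = σ x := by simp [hτ]
  have hex := ocl_exists_pow σ hxy
  have hk := Nat.find_spec hex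
  set k := Nat.find hex with hkdef
  have hk0 : 0 < k := by
    rcases Nat.eq_zero_or_pos k with h | h
    · rw [h] at hk; exact absurd (by simpa using hk) hne
    · exact h
  have hmin : ∀ i, 1 ≤ i → i ≤ k → (σ ^ i) x ≠ x := by
    intro i h1 h2 h
    refine Nat.find_min hex (m := k - i) (by omega) ?_
    calc (σ ^ (k - i)) x = (σ ^ (k - i)) ((σ ^ i) x) := by rw [h]
      _ = (σ ^ k) x := by rw [← Equiv.Perm.mul_apply, ← pow_add]; congr 2; omega
      _ = y := hk
  intro h
  obtain ⟨m, hm⟩ := ocl_exists_pow τ h.symm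
  have key : ∀ m : ℕ, ∃ i, 1 ≤ i ∧ i ≤ k ∧ (τ ^ m) y = (σ ^ i) x := by
    intro m
    induction m with
    | zero => exact ⟨k, hk0, le_rfl, by simp [hk]⟩
    | succ m ih =>
      obtain ⟨i, h1, h2, h3⟩ := ih
      rw [pow_succ', Equiv.Perm.mul_apply, h3]
      rcases h2.lt_or_eq with h4 | h4
      · refine ⟨i + 1, by omega, by omega, ?_⟩
        rw [hτo _ (hmin i h1 h2), pow_succ', Equiv.Perm.mul_apply]
        exact fun h5 => Nat.find_min hex h4 h5
      · refine ⟨1, le_rfl, hk0, ?_⟩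
        rw [h4, hk, hτy, pow_one]
  obtain ⟨i, h1, h2, h3⟩ := key m
  exact hmin i h1 h2 (by rw [← h3, hm])

lemma numOrb_swap {T : Type*} [Finite T] (σ : Equiv.Perm T) (x y : T) (hne : x ≠ y) :
    numOrb (σ * Equiv.swap x y : Equiv.Perm T) + 1 = numOrb σ ∨
    numOrb (σ * Equiv.swap x y : Equiv.Perm T) = numOrb σ + 1 := by
  by_cases h : ocl σ x = ocl σ y
  · right
    have := numOrb_merge (σ * Equiv.swap x y) x y (ocl_split σ x y hne h)
    rw [mul_assoc, Equiv.swap_mul_self, mul_one] at this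
    exact this.symm
  · exact Or.inl (numOrb_merge σ x y h)

lemma numOrb_invol {T : Type*} [Fintype T] (σ : Equiv.Perm T) :
    ∀ (m : ℕ) (β : Equiv.Perm T), (∀ z, β (β z) = z) → β.support.card = m →
      ∃ k j, m = 2 * k ∧ numOrb (σ * β : Equiv.Perm T) + 2 * j = numOrb σ + k := by
  intro m
  induction m using Nat.strong_induction_on with
  | _ m ih =>
    intro β hβ hm
    by_cases h : ∃ x, β x ≠ x
    · obtain ⟨x, hx⟩ := h
      set β' := β * Equiv.swap x (β x) with hβ'
      have b1 : β' x = x := by simp [hβ', hβ]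
      have b2 : β' (β x) = β x := by simp [hβ']
      have b3 : ∀ z, z ≠ x → z ≠ β x → β' z = β z := by
        intro z h1 h2
        simp [hβ', Equiv.swap_apply_of_ne_of_ne h1 h2]
      have hinv : ∀ z, β' (β' z) = z := by
        intro z
        by_cases h1 : z = x
        · rw [h1, b1, b1]
        by_cases h2 : z = β x
        · rw [h2, b2, b2]
        rw [b3 z h1 h2, b3, hβ]
        · intro h; exact h2 (by rw [← h, hβ])
        · intro h; exact h1 (β.injective h)
      have hs : β.support = insert x (insert (β x) β'.support) := by
        ext z
        simp only [Finset.mem_insert, Equiv.Perm.mem_support]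
        by_cases h1 : z = x
        · simp [h1, hx]
        by_cases h2 : z = β x
        · simp [h2, hβ, hx.symm]
        simp [h1, h2, b3 z h1 h2]
      have hc : β.support.card = β'.support.card + 2 := by
        rw [hs, Finset.card_insert_of_notMem, Finset.card_insert_of_notMem]
        · simp [b2]
        · simp [b1, hx.symm]
      obtain ⟨k, j, hk, hj⟩ := ih β'.support.card (by omega) β' hinv rfl
      have heq : σ * β = (σ * β') * Equiv.swap x (β x) := by
        rw [hβ', mul_assoc, mul_assoc, Equiv.swap_mul_self, mul_one]
      rw [heq]
      rcases numOrb_swap (σ * β') x (β x) hx.symm with h | h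
      · exact ⟨k + 1, j + 1, by omega, by omega⟩
      · exact ⟨k + 1, j, by omega, by omega⟩
    · push Not at h
      have : β = 1 := by ext z; simp [h]
      subst this
      refine ⟨0, 0, ?_, by simp⟩
      simpa using hm.symm

lemma numOrb_conj {T U : Type*} (e : T ≃ U) (f : T → T) (g : U → U)
    (h : ∀ t, g (e t) = e (f t)) : numOrb f = numOrb g := by
  refine Nat.card_congr (Quot.congr e ?_)
  intro a b
  rw [h, e.apply_eq_iff_eq]

lemma numOrb_sum {T U : Type*} [Finite T] [Finite U] (f : T → T) (g : U → U) :
    numOrb (Sum.map f g) = numOrb f + numOrb g := by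
  have : Finite (Quot (fun x y => y = f x)) := Quot.finite _
  have : Finite (Quot (fun x y => y = g x)) := Quot.finite _
  unfold numOrb
  rw [← Nat.card_sum]
  refine Nat.card_congr
    { toFun := Quot.lift (Sum.map (ocl f) (ocl g)) ?_
      invFun := Sum.elim (Quot.lift (fun a => ocl (Sum.map f g) (Sum.inl a)) ?_)
        (Quot.lift (fun a => ocl (Sum.map f g) (Sum.inr a)) ?_)
      left_inv := ?_
      right_inv := ?_ }
  · rintro (a | a) b rfl <;> simp [ocl_step]
  · rintro a b rfl
    exact (ocl_step (Sum.map f g) (Sum.inl a)).symm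
  · rintro a b rfl
    exact (ocl_step (Sum.map f g) (Sum.inr a)).symm
  · rintro ⟨a | a⟩ <;> rfl
  · rintro (a | a) <;> induction a using Quot.ind <;> rfl

lemma ocl_sum_ne {T U : Type*} (f : T → T) (g : U → U) (a : T) (b : U) :
    ocl (Sum.map f g) (Sum.inl a) ≠ ocl (Sum.map f g) (Sum.inr b) := by
  intro h
  have := congrArg (Quot.lift (fun t : T ⊕ U => t.isLeft) (by
    rintro (a | a) b rfl <;> rfl)) h
  exact absurd this (by simp [ocl])

def IsNx {T : Type*} (v : T → ℕ) (a b : T) : Prop :=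
  (v a < v b ∧ ∀ c, ¬ (v a < v c ∧ v c < v b)) ∨ ((∀ c, v c ≤ v a) ∧ ∀ c, v b ≤ v c)

lemma IsNx.unique {T : Type*} {v : T → ℕ} (hv : Function.Injective v) {a b b' : T}
    (h : IsNx v a b) (h' : IsNx v a b') : b = b' := by
  apply hv
  rcases h with ⟨h1, h2⟩ | ⟨h1, h2⟩ <;> rcases h' with ⟨h3, h4⟩ | ⟨h3, h4⟩
  · have := h2 b'; have := h4 b; omega
  · have := h3 b; omega
  · have := h1 b'; omega
  · have := h2 b'; have := h4 b; omega

lemma IsNx.inj {T : Type*} {v : T → ℕ} (hv : Function.Injective v) {a a' b : T}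
    (h : IsNx v a b) (h' : IsNx v a' b) : a = a' := by
  apply hv
  rcases h with ⟨h1, h2⟩ | ⟨h1, h2⟩ <;> rcases h' with ⟨h3, h4⟩ | ⟨h3, h4⟩
  · have := h2 a'; have := h4 a; omega
  · have := h4 a; omega
  · have := h2 a'; omega
  · have := h1 a'; have := h3 a; omega

lemma numOrb_nx {T : Type*} [Finite T] [Nonempty T] {v : T → ℕ} (hv : Function.Injective v)
    (ρ : T → T) (hρ : ∀ a, IsNx v a (ρ a)) : numOrb ρ = 1 := by
  have hinj : Function.Injective ρ := fun a b h => (hρ a).inj hv (h ▸ hρ b)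
  have hsurj : Function.Surjective ρ := Finite.surjective_of_injective hinj
  obtain ⟨m, hm⟩ := Finite.exists_min v
  have key : ∀ k z, v z = k → ocl ρ z = ocl ρ m := by
    intro k
    induction k using Nat.strong_induction_on with
    | _ k ih =>
      intro z hz
      obtain ⟨a, rfl⟩ := hsurj z
      rcases hρ a with ⟨h1, h2⟩ | ⟨h1, h2⟩
      · rw [ocl_step]; exact ih (v a) (by omega) a rfl
      · have : ρ a = m := hv (le_antisymm (h2 m) (hm _))
        rw [this]
  unfold numOrb
  rw [Nat.card_eq_one_iff_unique]
  refine ⟨⟨?_⟩, ⟨ocl ρ m⟩⟩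
  intro a b
  induction a using Quot.ind
  induction b using Quot.ind
  exact (key _ _ rfl).trans (key _ _ rfl).symm

lemma join_nx {T₁ T₂ T : Type*} [DecidableEq (T₁ ⊕ T₂)] {v₁ : T₁ → ℕ} {v₂ : T₂ → ℕ} {v : T → ℕ}
    (hv₁ : Function.Injective v₁) (hv₂ : Function.Injective v₂)
    (hv : Function.Injective v) (N : ℕ) (e : T₁ ⊕ T₂ ≃ T)
    (he₁ : ∀ a, v (e (Sum.inl a)) = v₁ a) (he₂ : ∀ a, v (e (Sum.inr a)) = N + v₂ a)
    (hN : ∀ a, v₁ a < N) (ρ₁ : T₁ → T₁) (ρ₂ : T₂ → T₂) (ρ : T → T)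
    (hρ₁ : ∀ a, IsNx v₁ a (ρ₁ a)) (hρ₂ : ∀ a, IsNx v₂ a (ρ₂ a)) (hρ : ∀ a, IsNx v a (ρ a))
    (M₁ : T₁) (M₂ : T₂) (hM₁ : ∀ a, v₁ a ≤ v₁ M₁) (hM₂ : ∀ a, v₂ a ≤ v₂ M₂) (t : T₁ ⊕ T₂) :
    ρ (e t) = e (Sum.map ρ₁ ρ₂ (Equiv.swap (Sum.inl M₁) (Sum.inr M₂) t)) := by
  refine (hρ (e t)).unique hv ?_
  have hall : ∀ P : T → Prop, (∀ a, P (e (Sum.inl a))) → (∀ a, P (e (Sum.inr a))) → ∀ c, P c := by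
    intro P h1 h2 c
    obtain ⟨d | d, rfl⟩ := e.surjective c
    · exact h1 d
    · exact h2 d
  by_cases h1 : t = Sum.inl M₁
  · subst h1
    rw [Equiv.swap_apply_left, Sum.map_inr]
    have hmin : ∀ c, v₂ (ρ₂ M₂) ≤ v₂ c := by
      rcases hρ₂ M₂ with ⟨h, _⟩ | ⟨_, h⟩
      · have := hM₂ (ρ₂ M₂); omega
      · exact h
    left
    refine ⟨by rw [he₁, he₂]; have := hN M₁; omega, hall _ ?_ ?_⟩
    · intro a; simp only [he₁, he₂]; have := hM₁ a; omega
    · intro a; simp only [he₁, he₂]; have := hmin a; omega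
  by_cases h2 : t = Sum.inr M₂
  · subst h2
    rw [Equiv.swap_apply_right, Sum.map_inl]
    have hmin : ∀ c, v₁ (ρ₁ M₁) ≤ v₁ c := by
      rcases hρ₁ M₁ with ⟨h, _⟩ | ⟨_, h⟩
      · have := hM₁ (ρ₁ M₁); omega
      · exact h
    right
    refine ⟨hall _ ?_ ?_, hall _ ?_ ?_⟩ <;> intro a <;> simp only [he₁, he₂]
    · have := hN a; omega
    · have := hM₂ a; omega
    · exact hmin a
    · have := hN (ρ₁ M₁); omega
  rw [Equiv.swap_apply_of_ne_of_ne h1 h2]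
  left
  rcases t with a | a
  · have hne : v₁ a ≠ v₁ M₁ := fun h => h1 (by rw [hv₁ h])
    have := hM₁ a
    rcases hρ₁ a with ⟨h, h'⟩ | ⟨h, _⟩
    · rw [Sum.map_inl]
      refine ⟨by simpa only [he₁] using h, hall _ ?_ ?_⟩ <;> intro c <;> simp only [he₁, he₂]
      · exact h' c
      · have := hN (ρ₁ a); omega
    · have := h M₁; omega
  · have hne : v₂ a ≠ v₂ M₂ := fun h => h2 (by rw [hv₂ h])
    have := hM₂ a
    rcases hρ₂ a with ⟨h, h'⟩ | ⟨h, _⟩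
    · rw [Sum.map_inr]
      refine ⟨by simpa only [he₂, add_lt_add_iff_left] using h, hall _ ?_ ?_⟩ <;>
        intro c <;> simp only [he₁, he₂]
      · have := hN c; omega
      · have := h' c; omega
    · have := h M₂; omega

lemma shift_nx {T₁ T : Type*} {v₁ : T₁ → ℕ} {v : T → ℕ}
    (hv : Function.Injective v) (N : ℕ) (e : T₁ ≃ T)
    (he : ∀ a, v (e a) = N + v₁ a) (ρ₁ : T₁ → T₁) (ρ : T → T)
    (hρ₁ : ∀ a, IsNx v₁ a (ρ₁ a)) (hρ : ∀ a, IsNx v a (ρ a)) (t : T₁) :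
    ρ (e t) = e (ρ₁ t) := by
  refine (hρ (e t)).unique hv ?_
  rcases hρ₁ t with ⟨h, h'⟩ | ⟨h, h'⟩
  · left
    refine ⟨by rw [he, he]; omega, e.surjective.forall.2 fun c => ?_⟩
    have := h' c
    simp only [he]; omega
  · right
    refine ⟨e.surjective.forall.2 fun c => ?_, e.surjective.forall.2 fun c => ?_⟩
    · have := h c
      simp only [he]; omega
    · have := h' c
      simp only [he]; omega

lemma firstAfter_spec (n : ℕ) (S : Set (ZMod (2 * n))) (hn : 1 ≤ n) (y : ZMod (2 * n))
    (hy : y ∈ S) : ∃ k : ℕ, 0 < k ∧ k ≤ 2 * n ∧ firstAfter n S y = y + (k : ZMod (2 * n)) ∧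
      y + (k : ZMod (2 * n)) ∈ S ∧ ∀ j : ℕ, 0 < j → j < k → y + (j : ZMod (2 * n)) ∉ S := by
  have h2 : 0 < 2 * n ∧ y + ((2 * n : ℕ) : ZMod (2 * n)) ∈ S := by
    refine ⟨by omega, ?_⟩
    rw [ZMod.natCast_self, add_zero]; exact hy
  have h : ∃ k : ℕ, 0 < k ∧ y + (k : ZMod (2 * n)) ∈ S := ⟨2 * n, h2⟩
  refine ⟨Nat.find h, (Nat.find_spec h).1, Nat.find_min' h h2, ?_, (Nat.find_spec h).2, ?_⟩
  · unfold firstAfter; rw [dif_pos h]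
  · intro j hj hjk hm
    exact Nat.find_min h hjk ⟨hj, hm⟩

lemma firstAfter_mem (n : ℕ) (S : Set (ZMod (2 * n))) (hn : 1 ≤ n) (y : ZMod (2 * n))
    (hy : y ∈ S) : firstAfter n S y ∈ S := by
  obtain ⟨k, _, _, h, h', _⟩ := firstAfter_spec n S hn y hy
  rw [h]; exact h'

noncomputable def rhoS (n : ℕ) (S : Set (ZMod (2 * n))) (hn : 1 ≤ n) (y : S) : S :=
  ⟨firstAfter n S y, firstAfter_mem n S hn y y.2⟩

def vS (n : ℕ) (S : Set (ZMod (2 * n))) (y : S) : ℕ := y.1.val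

lemma vS_inj (n : ℕ) (S : Set (ZMod (2 * n))) (hn : 1 ≤ n) : Function.Injective (vS n S) := by
  have : NeZero (2 * n) := ⟨by omega⟩
  intro a b h
  exact Subtype.ext (ZMod.val_injective _ h)

lemma rhoS_nx (n : ℕ) (S : Set (ZMod (2 * n))) (hn : 1 ≤ n) (y : S) :
    IsNx (vS n S) y (rhoS n S hn y) := by
  have : NeZero (2 * n) := ⟨by omega⟩
  obtain ⟨k, hk0, hk, h, h', hmin⟩ := firstAfter_spec n S hn y y.2
  have hyv : y.1 = ((vS n S y : ℕ) : ZMod (2 * n)) := by simp [vS]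
  have hlt : ∀ c : S, vS n S c < 2 * n := fun c => ZMod.val_lt _
  have hrv : vS n S (rhoS n S hn y) = (vS n S y + k) % (2 * n) := by
    change (firstAfter n S y).val = _
    rw [h, hyv, ← Nat.cast_add, ZMod.val_natCast]
  have hno : ∀ j, 0 < j → j < k → ∀ c : S, vS n S c ≠ vS n S y + j ∧
      vS n S c + 2 * n ≠ vS n S y + j := by
    intro j hj hjk c
    have hc : c.1 = ((vS n S c : ℕ) : ZMod (2 * n)) := by simp [vS]
    constructor
    · intro hh
      refine hmin j hj hjk ?_
      rw [hyv, ← Nat.cast_add, ← hh, ← hc]; exact c.2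
    · intro hh
      refine hmin j hj hjk ?_
      rw [hyv, ← Nat.cast_add, ← hh, Nat.cast_add, ZMod.natCast_self, add_zero, ← hc]; exact c.2
  have hy := hlt y
  by_cases hw : vS n S y + k < 2 * n
  · rw [Nat.mod_eq_of_lt hw] at hrv
    left
    refine ⟨by omega, fun c hc => ?_⟩
    exact (hno (vS n S c - vS n S y) (by omega) (by omega) c).1 (by omega)
  · rw [Nat.mod_eq_sub_mod (by omega), Nat.mod_eq_of_lt (by omega)] at hrv
    right
    refine ⟨fun c => ?_, fun c => ?_⟩
    · by_contra hc
      have := hlt c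
      exact (hno (vS n S c - vS n S y) (by omega) (by omega) c).1 (by omega)
    · by_contra hc
      exact (hno (vS n S c + 2 * n - vS n S y) (by omega) (by omega) c).2 (by omega)

noncomputable def rhoP (n : ℕ) (S : Set (ZMod (2 * n))) (hn : 1 ≤ n) : Equiv.Perm S :=
  haveI : NeZero (2 * n) := ⟨by omega⟩
  Equiv.ofBijective (rhoS n S hn) (Finite.injective_iff_bijective.1
    fun a b h => (rhoS_nx n S hn a).inj (vS_inj n S hn) (h ▸ rhoS_nx n S hn b))

def alS (n : ℕ) (α : Equiv.Perm (ZMod (2 * n))) (hα : ∀ x, α (α x) = x)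
    (S : Set (ZMod (2 * n))) (hS : ∀ x ∈ S, α x ∈ S) : Equiv.Perm S where
  toFun x := ⟨α x, hS x x.2⟩
  invFun x := ⟨α x, hS x x.2⟩
  left_inv x := Subtype.ext (hα x)
  right_inv x := Subtype.ext (hα x)

lemma orbitCount_eq_s12 (n : ℕ) (hn : 1 ≤ n) (α : Equiv.Perm (ZMod (2 * n))) (hα : ∀ x, α (α x) = x)
    (S : Set (ZMod (2 * n))) (hS : ∀ x ∈ S, α x ∈ S) (hne : S.Nonempty) :
    orbitCount n α S = numOrb (rhoP n S hn * alS n α hα S hS : Equiv.Perm S) := by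
  set π := rhoP n S hn * alS n α hα S hS with hπ
  have hπv : ∀ x : S, (π x : ZMod (2 * n)) = firstAfter n S (α x) := fun x => rfl
  unfold orbitCount
  rw [if_neg hne.ne_empty, ← Nat.card_coe_set_eq]
  unfold numOrb
  symm
  have h1 : ∀ a b : ZMod (2 * n), Relation.EqvGen (boundaryStep n α S) a b →
      a = b ∨ ∃ (ha : a ∈ S) (hb : b ∈ S), ocl π ⟨a, ha⟩ = ocl π ⟨b, hb⟩ := by
    intro a b h
    induction h with
    | rel x y h =>
      obtain ⟨hx, rfl⟩ := h
      exact Or.inr ⟨hx, firstAfter_mem n S hn _ (hS x hx), (ocl_step π ⟨x, hx⟩).symm⟩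
    | refl x => exact Or.inl rfl
    | symm x y _ ih =>
      rcases ih with h | ⟨h1, h2, h3⟩
      · exact Or.inl h.symm
      · exact Or.inr ⟨h2, h1, h3.symm⟩
    | trans x y z _ _ ih1 ih2 =>
      rcases ih1 with rfl | ⟨h1, h2, h3⟩
      · exact ih2
      · rcases ih2 with rfl | ⟨h4, h5, h6⟩
        · exact Or.inr ⟨h1, h2, h3⟩
        · exact Or.inr ⟨h1, h5, h3.trans h6⟩
  have hcl : ∀ a b, Relation.EqvGen (boundaryStep n α S) a b →
      {y | Relation.EqvGen (boundaryStep n α S) a y} =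
        {y | Relation.EqvGen (boundaryStep n α S) b y} := by
    intro a b h
    ext y
    exact ⟨fun h' => (h.symm).trans _ _ _ h', fun h' => h.trans _ _ _ h'⟩
  refine Nat.card_congr (Equiv.ofBijective (Quot.lift (fun x : S =>
    (⟨{y | Relation.EqvGen (boundaryStep n α S) x y}, x, x.2, rfl⟩ :
      ((fun x => {y | Relation.EqvGen (boundaryStep n α S) x y}) '' S : Set _))) ?_) ⟨?_, ?_⟩)
  · rintro a b rfl
    exact Subtype.ext (hcl _ _ (Relation.EqvGen.rel _ _ ⟨a.2, rfl⟩))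
  · intro a b h
    induction a using Quot.ind with | _ a
    induction b using Quot.ind with | _ b
    have h2 := congrArg Subtype.val h
    change {y | Relation.EqvGen (boundaryStep n α S) a y} =
      {y | Relation.EqvGen (boundaryStep n α S) b y} at h2
    have h3 : (b : ZMod (2 * n)) ∈ {y | Relation.EqvGen (boundaryStep n α S) a y} := by
      rw [h2]; exact Relation.EqvGen.refl _
    rcases h1 _ _ h3 with h | ⟨_, _, h⟩
    · rw [Subtype.ext h]
    · exact h
  · rintro ⟨_, x, hx, rfl⟩
    exact ⟨ocl π ⟨x, hx⟩, rfl⟩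

lemma orbitCount_facts (n : ℕ) (hn : 1 ≤ n) (α : Equiv.Perm (ZMod (2 * n)))
    (hα : ∀ x, α (α x) = x) (hf : ∀ x, α x ≠ x)
    (S : Set (ZMod (2 * n))) (hS : ∀ x ∈ S, α x ∈ S) :
    ∃ k j, S.ncard = 2 * k ∧ orbitCount n α S + 2 * j = 1 + k := by
  have : NeZero (2 * n) := ⟨by omega⟩
  rcases S.eq_empty_or_nonempty with h | h
  · subst h
    exact ⟨0, 0, by simp, by simp [orbitCount]⟩
  · have : Nonempty S := h.to_subtype
    have : Fintype S := Fintype.ofFinite _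
    have hsupp : (alS n α hα S hS).support = Finset.univ := by
      ext x
      simp only [Equiv.Perm.mem_support, Finset.mem_univ, iff_true]
      exact fun h => hf x (congrArg Subtype.val h)
    obtain ⟨k, j, h1, h2⟩ := numOrb_invol (rhoP n S hn) _ (alS n α hα S hS)
      (fun z => Subtype.ext (hα z)) rfl
    refine ⟨k, j, ?_, ?_⟩
    · rw [← h1, (Finset.card_eq_iff_eq_univ _).2 (by convert hsupp), ← Nat.card_coe_set_eq, Nat.card_eq_fintype_card]
    · rw [orbitCount_eq_s12 n hn α hα S hS h, h2]
      congr 1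
      exact numOrb_nx (vS_inj n S hn) _ (rhoS_nx n S hn)

def joinF (n₁ n₂ : ℕ) : ZMod (2 * n₁) ⊕ ZMod (2 * n₂) → ZMod (2 * (n₁ + n₂)) :=
  Sum.elim (fun x => ((x.val : ℕ) : ZMod (2 * (n₁ + n₂))))
    (fun x => ((2 * n₁ + x.val : ℕ) : ZMod (2 * (n₁ + n₂))))

lemma joinF_inl (n₁ n₂ : ℕ) (h₁ : 1 ≤ n₁) (x : ZMod (2 * n₁)) :
    (joinF n₁ n₂ (Sum.inl x)).val = x.val := by
  have : NeZero (2 * n₁) := ⟨by omega⟩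
  have := ZMod.val_lt x
  change ((x.val : ℕ) : ZMod (2 * (n₁ + n₂))).val = _
  rw [ZMod.val_natCast, Nat.mod_eq_of_lt (by omega)]

lemma joinF_inr (n₁ n₂ : ℕ) (h₂ : 1 ≤ n₂) (x : ZMod (2 * n₂)) :
    (joinF n₁ n₂ (Sum.inr x)).val = 2 * n₁ + x.val := by
  have : NeZero (2 * n₂) := ⟨by omega⟩
  have := ZMod.val_lt x
  change ((2 * n₁ + x.val : ℕ) : ZMod (2 * (n₁ + n₂))).val = _
  rw [ZMod.val_natCast, Nat.mod_eq_of_lt (by omega)]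

lemma joinF_bij (n₁ n₂ : ℕ) (h₁ : 1 ≤ n₁) (h₂ : 1 ≤ n₂) : Function.Bijective (joinF n₁ n₂) := by
  have : NeZero (2 * n₁) := ⟨by omega⟩
  have : NeZero (2 * n₂) := ⟨by omega⟩
  have : NeZero (2 * (n₁ + n₂)) := ⟨by omega⟩
  rw [Fintype.bijective_iff_injective_and_card]
  constructor
  · rintro (a | a) (b | b) h <;> have h' := congrArg ZMod.val h <;>
      simp only [joinF_inl n₁ n₂ h₁, joinF_inr n₁ n₂ h₂] at h'
    · rw [ZMod.val_injective _ h']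
    · have := ZMod.val_lt a; omega
    · have := ZMod.val_lt b; omega
    · rw [ZMod.val_injective _ (Nat.add_left_cancel h')]
  · simp only [Fintype.card_sum, ZMod.card]; ring

lemma join_count (n₁ n₂ : ℕ) (h₁ : 1 ≤ n₁) (h₂ : 1 ≤ n₂)
    (α₁ : Equiv.Perm (ZMod (2 * n₁))) (α₂ : Equiv.Perm (ZMod (2 * n₂)))
    (α : Equiv.Perm (ZMod (2 * (n₁ + n₂))))
    (hinv₁ : ∀ x, α₁ (α₁ x) = x) (hinv₂ : ∀ x, α₂ (α₂ x) = x) (hinv : ∀ x, α (α x) = x)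
    (hα : ∀ t, α (joinF n₁ n₂ t) = joinF n₁ n₂ (Sum.map α₁ α₂ t))
    (S : Set (ZMod (2 * (n₁ + n₂)))) (hS : ∀ x ∈ S, α x ∈ S) :
    orbitCount (n₁ + n₂) α S + 1 = orbitCount n₁ α₁ {x | joinF n₁ n₂ (Sum.inl x) ∈ S} +
      orbitCount n₂ α₂ {x | joinF n₁ n₂ (Sum.inr x) ∈ S} := by
  have : NeZero (2 * n₁) := ⟨by omega⟩
  have : NeZero (2 * n₂) := ⟨by omega⟩
  have : NeZero (2 * (n₁ + n₂)) := ⟨by omega⟩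
  have hn : 1 ≤ n₁ + n₂ := by omega
  set S₁ : Set (ZMod (2 * n₁)) := {x | joinF n₁ n₂ (Sum.inl x) ∈ S} with hS₁def
  set S₂ : Set (ZMod (2 * n₂)) := {x | joinF n₁ n₂ (Sum.inr x) ∈ S} with hS₂def
  have hS₁ : ∀ x ∈ S₁, α₁ x ∈ S₁ := by
    intro x hx
    have := hS _ hx
    rw [hα] at this
    exact this
  have hS₂ : ∀ x ∈ S₂, α₂ x ∈ S₂ := by
    intro x hx
    have := hS _ hx
    rw [hα] at this
    exact this
  have hbij := joinF_bij n₁ n₂ h₁ h₂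
  let e₁ : S₁ → S := fun a => ⟨joinF n₁ n₂ (Sum.inl a.1), a.2⟩
  let e₂ : S₂ → S := fun a => ⟨joinF n₁ n₂ (Sum.inr a.1), a.2⟩
  have hv₁ : ∀ a, vS _ S (e₁ a) = vS _ S₁ a := fun a => joinF_inl n₁ n₂ h₁ a.1
  have hv₂ : ∀ a, vS _ S (e₂ a) = 2 * n₁ + vS _ S₂ a := fun a => joinF_inr n₁ n₂ h₂ a.1
  have he₁ : Function.Injective e₁ := by
    intro a b h
    exact Subtype.ext (Sum.inl_injective (hbij.1 (congrArg Subtype.val h)))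
  have he₂ : Function.Injective e₂ := by
    intro a b h
    exact Subtype.ext (Sum.inr_injective (hbij.1 (congrArg Subtype.val h)))
  have hsurj : ∀ c : S, (∃ a, e₁ a = c) ∨ ∃ a, e₂ a = c := by
    rintro ⟨c, hc⟩
    obtain ⟨t | t, rfl⟩ := hbij.2 c
    · exact Or.inl ⟨⟨t, hc⟩, rfl⟩
    · exact Or.inr ⟨⟨t, hc⟩, rfl⟩
  have ha₁ : ∀ a, alS _ α hinv S hS (e₁ a) = e₁ (alS _ α₁ hinv₁ S₁ hS₁ a) :=
    fun a => Subtype.ext (hα (Sum.inl a.1))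
  have ha₂ : ∀ a, alS _ α hinv S hS (e₂ a) = e₂ (alS _ α₂ hinv₂ S₂ hS₂ a) :=
    fun a => Subtype.ext (hα (Sum.inr a.1))
  rcases S₁.eq_empty_or_nonempty with hE₁ | hE₁
  · have c1 : orbitCount n₁ α₁ S₁ = 1 := by rw [hE₁]; simp [orbitCount]
    have hemp : IsEmpty S₁ := Set.isEmpty_coe_sort.2 hE₁
    have hb : Function.Bijective e₂ := ⟨he₂, fun c => (hsurj c).resolve_left
      (fun ⟨a, _⟩ => hemp.false a)⟩
    rcases S₂.eq_empty_or_nonempty with hE₂ | hE₂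
    · have c2 : orbitCount n₂ α₂ S₂ = 1 := by rw [hE₂]; simp [orbitCount]
      have hE : S = ∅ := by
        rw [Set.eq_empty_iff_forall_notMem]
        intro c hc
        obtain ⟨a, _⟩ := hb.2 ⟨c, hc⟩
        exact (Set.isEmpty_coe_sort.2 hE₂).false a
      have c3 : orbitCount (n₁ + n₂) α S = 1 := by rw [hE]; simp [orbitCount]
      omega
    · have hE : S.Nonempty := ⟨_, (e₂ ⟨_, hE₂.some_mem⟩).2⟩
      rw [c1, orbitCount_eq_s12 _ hn α hinv S hS hE, orbitCount_eq_s12 _ h₂ α₂ hinv₂ S₂ hS₂ hE₂, add_comm]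
      congr 1
      symm
      refine numOrb_conj (Equiv.ofBijective e₂ hb) _ _ ?_
      intro t
      change rhoS _ S hn (alS _ α hinv S hS (e₂ t)) = e₂ (rhoS _ S₂ h₂ (alS _ α₂ hinv₂ S₂ hS₂ t))
      rw [ha₂]
      exact shift_nx (vS_inj _ S hn) (2 * n₁) (Equiv.ofBijective e₂ hb) hv₂ _ _
        (rhoS_nx _ S₂ h₂) (rhoS_nx _ S hn) _
  · have hE : S.Nonempty := ⟨_, (e₁ ⟨_, hE₁.some_mem⟩).2⟩
    rcases S₂.eq_empty_or_nonempty with hE₂ | hE₂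
    · have c2 : orbitCount n₂ α₂ S₂ = 1 := by rw [hE₂]; simp [orbitCount]
      have hemp : IsEmpty S₂ := Set.isEmpty_coe_sort.2 hE₂
      have hb : Function.Bijective e₁ := ⟨he₁, fun c => (hsurj c).resolve_right
        (fun ⟨a, _⟩ => hemp.false a)⟩
      rw [c2, orbitCount_eq_s12 _ hn α hinv S hS hE, orbitCount_eq_s12 _ h₁ α₁ hinv₁ S₁ hS₁ hE₁]
      congr 1
      symm
      refine numOrb_conj (Equiv.ofBijective e₁ hb) _ _ ?_
      intro t
      change rhoS _ S hn (alS _ α hinv S hS (e₁ t)) = e₁ (rhoS _ S₁ h₁ (alS _ α₁ hinv₁ S₁ hS₁ t))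
      rw [ha₁]
      exact shift_nx (vS_inj _ S hn) 0 (Equiv.ofBijective e₁ hb)
        (fun a => by rw [zero_add]; exact hv₁ a) _ _
        (rhoS_nx _ S₁ h₁) (rhoS_nx _ S hn) _
    · have hb : Function.Bijective (Sum.elim e₁ e₂) := by
        refine ⟨?_, ?_⟩
        · refine Function.Injective.sumElim he₁ he₂ ?_
          intro a b h
          have h' : joinF n₁ n₂ (Sum.inl a.1) = joinF n₁ n₂ (Sum.inr b.1) := congrArg Subtype.val h
          exact absurd (hbij.1 h') (by simp)
        · intro c
          rcases hsurj c with ⟨a, h⟩ | ⟨a, h⟩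
          · exact ⟨Sum.inl a, h⟩
          · exact ⟨Sum.inr a, h⟩
      have : Nonempty S₁ := hE₁.to_subtype
      have : Nonempty S₂ := hE₂.to_subtype
      obtain ⟨M₁, hM₁⟩ := Finite.exists_max (vS _ S₁)
      obtain ⟨M₂, hM₂⟩ := Finite.exists_max (vS _ S₂)
      let e : S₁ ⊕ S₂ ≃ S := Equiv.ofBijective _ hb
      rw [orbitCount_eq_s12 _ hn α hinv S hS hE, orbitCount_eq_s12 _ h₁ α₁ hinv₁ S₁ hS₁ hE₁,
        orbitCount_eq_s12 _ h₂ α₂ hinv₂ S₂ hS₂ hE₂, ← numOrb_sum]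
      set π₁ := rhoP _ S₁ h₁ * alS _ α₁ hinv₁ S₁ hS₁ with hπ₁
      set π₂ := rhoP _ S₂ h₂ * alS _ α₂ hinv₂ S₂ hS₂ with hπ₂
      have hm := numOrb_merge (Equiv.Perm.sumCongr π₁ π₂) (Sum.inl (alS _ α₁ hinv₁ S₁ hS₁ M₁))
        (Sum.inr (alS _ α₂ hinv₂ S₂ hS₂ M₂)) (ocl_sum_ne π₁ π₂ _ _)
      refine Eq.trans ?_ hm
      congr 1
      symm
      refine numOrb_conj e _ _ ?_
      intro t
      let A : Equiv.Perm (S₁ ⊕ S₂) :=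
        Equiv.Perm.sumCongr (alS _ α₁ hinv₁ S₁ hS₁) (alS _ α₂ hinv₂ S₂ hS₂)
      have hAA : ∀ s, A (A s) = s := by
        rintro (s | s)
        · exact congrArg Sum.inl (Subtype.ext (hinv₁ _))
        · exact congrArg Sum.inr (Subtype.ext (hinv₂ _))
      have hA : alS _ α hinv S hS (e t) = e (A t) := by
        rcases t with t | t
        · exact ha₁ t
        · exact ha₂ t
      have hsw : Equiv.swap (Sum.inl M₁) (Sum.inr M₂) (A t) =
          A (Equiv.swap (A (Sum.inl M₁)) (A (Sum.inr M₂)) t) := by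
        have h := Equiv.swap_apply_apply A (A (Sum.inl M₁)) (A (Sum.inr M₂))
        rw [hAA, hAA] at h
        rw [h]
        simp only [Equiv.Perm.mul_apply]
        congr 2
        exact A.symm_apply_apply t
      have hj := join_nx (vS_inj _ S₁ h₁) (vS_inj _ S₂ h₂) (vS_inj _ S hn) (2 * n₁) e
        hv₁ hv₂ (fun a => ZMod.val_lt _) _ _ _ (rhoS_nx _ S₁ h₁) (rhoS_nx _ S₂ h₂)
        (rhoS_nx _ S hn) M₁ M₂ hM₁ hM₂ (A t)
      change rhoS _ S hn (alS _ α hinv S hS (e t)) = _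
      rw [hA, hj, hsw, Equiv.Perm.mul_apply]
      congr 1
      change _ = Equiv.Perm.sumCongr π₁ π₂ (Equiv.swap (A (Sum.inl M₁)) (A (Sum.inr M₂)) t)
      generalize Equiv.swap (A (Sum.inl M₁)) (A (Sum.inr M₂)) t = s
      rcases s with s | s <;> rfl

/-- For the join `α` of two chord diagrams `α₁`, `α₂`, the genus of partial duals is
additive, `g(α, A) = g(α₁, A₁) + g(α₂, A₂)`, and consequently the partial-dual genus
polynomial is multiplicative: `∂Γ_α = ∂Γ_{α₁} · ∂Γ_{α₂}`. -/
theorem join_genus_additive_poly_multiplicative (n₁ n₂ : ℕ) (h₁ : 1 ≤ n₁) (h₂ : 1 ≤ n₂)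
    (α₁ : Equiv.Perm (ZMod (2 * n₁))) (α₂ : Equiv.Perm (ZMod (2 * n₂)))
    (α : Equiv.Perm (ZMod (2 * (n₁ + n₂))))
    (hinv₁ : ∀ x, α₁ (α₁ x) = x) (hfree₁ : ∀ x, α₁ x ≠ x)
    (hinv₂ : ∀ x, α₂ (α₂ x) = x) (hfree₂ : ∀ x, α₂ x ≠ x)
    (hjoin₁ : ∀ i : ℕ, i < 2 * n₁ →
      α ((i : ℕ) : ZMod (2 * (n₁ + n₂))) =
        (((α₁ ((i : ℕ) : ZMod (2 * n₁))).val : ℕ) : ZMod (2 * (n₁ + n₂))))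
    (hjoin₂ : ∀ j : ℕ, j < 2 * n₂ →
      α ((2 * n₁ + j : ℕ) : ZMod (2 * (n₁ + n₂))) =
        ((2 * n₁ + (α₂ ((j : ℕ) : ZMod (2 * n₂))).val : ℕ) : ZMod (2 * (n₁ + n₂)))) :
    (∀ S : Set (ZMod (2 * (n₁ + n₂))), (∀ x ∈ S, α x ∈ S) →
      pdGenus (n₁ + n₂) α S =
        pdGenus n₁ α₁ {x : ZMod (2 * n₁) | ((x.val : ℕ) : ZMod (2 * (n₁ + n₂))) ∈ S} +
        pdGenus n₂ α₂
          {x : ZMod (2 * n₂) | ((2 * n₁ + x.val : ℕ) : ZMod (2 * (n₁ + n₂))) ∈ S}) ∧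
    pdPoly (n₁ + n₂) (by omega) α = pdPoly n₁ (by omega) α₁ * pdPoly n₂ (by omega) α₂ := by
  have hα : ∀ t, α (joinF n₁ n₂ t) = joinF n₁ n₂ (Sum.map α₁ α₂ t) := by
    have : NeZero (2 * n₁) := ⟨by omega⟩
    have : NeZero (2 * n₂) := ⟨by omega⟩
    rintro (t | t)
    · have := hjoin₁ t.val (ZMod.val_lt t)
      rw [ZMod.natCast_zmod_val t] at this
      exact this
    · have := hjoin₂ t.val (ZMod.val_lt t)
      rw [ZMod.natCast_zmod_val t] at this
      exact this
  have hbij := joinF_bij n₁ n₂ h₁ h₂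
  have hinv : ∀ x, α (α x) = x := by
    intro x
    obtain ⟨t, rfl⟩ := hbij.2 x
    rw [hα, hα]
    rcases t with t | t <;> simp [hinv₁, hinv₂]
  have hgenus : ∀ S : Set (ZMod (2 * (n₁ + n₂))), (∀ x ∈ S, α x ∈ S) →
      pdGenus (n₁ + n₂) α S = pdGenus n₁ α₁ {x | joinF n₁ n₂ (Sum.inl x) ∈ S} +
        pdGenus n₂ α₂ {x | joinF n₁ n₂ (Sum.inr x) ∈ S} := by
    intro S hS
    have : NeZero (2 * n₁) := ⟨by omega⟩
    have : NeZero (2 * n₂) := ⟨by omega⟩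
    have hc : ∀ {m : ℕ} (β : Equiv.Perm (ZMod (2 * m))), (∀ x, β (β x) = x) →
        ∀ S : Set (ZMod (2 * m)), (∀ x ∈ S, β x ∈ S) → ∀ x ∈ Sᶜ, β x ∈ Sᶜ := by
      intro m β hβ S hS x hx hx'
      exact hx (by simpa [hβ] using hS _ hx')
    have hS₁ : ∀ x ∈ {x | joinF n₁ n₂ (Sum.inl x) ∈ S}, α₁ x ∈ {x | joinF n₁ n₂ (Sum.inl x) ∈ S} := by
      intro x hx
      have := hS _ hx
      rw [hα] at this
      exact this
    have hS₂ : ∀ x ∈ {x | joinF n₁ n₂ (Sum.inr x) ∈ S}, α₂ x ∈ {x | joinF n₁ n₂ (Sum.inr x) ∈ S} := by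
      intro x hx
      have := hS _ hx
      rw [hα] at this
      exact this
    have e1 := join_count n₁ n₂ h₁ h₂ α₁ α₂ α hinv₁ hinv₂ hinv hα S hS
    have e2 := join_count n₁ n₂ h₁ h₂ α₁ α₂ α hinv₁ hinv₂ hinv hα Sᶜ (hc α hinv S hS)
    change _ = orbitCount n₁ α₁ {x | joinF n₁ n₂ (Sum.inl x) ∈ S}ᶜ +
      orbitCount n₂ α₂ {x | joinF n₁ n₂ (Sum.inr x) ∈ S}ᶜ at e2
    generalize {x | joinF n₁ n₂ (Sum.inl x) ∈ S} = S₁ at *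
    generalize {x | joinF n₁ n₂ (Sum.inr x) ∈ S} = S₂ at *
    obtain ⟨k1, j1, f1, g1⟩ := orbitCount_facts n₁ h₁ α₁ hinv₁ hfree₁ S₁ hS₁
    obtain ⟨k2, j2, f2, g2⟩ := orbitCount_facts n₁ h₁ α₁ hinv₁ hfree₁ S₁ᶜ (hc α₁ hinv₁ _ hS₁)
    obtain ⟨k3, j3, f3, g3⟩ := orbitCount_facts n₂ h₂ α₂ hinv₂ hfree₂ S₂ hS₂
    obtain ⟨k4, j4, f4, g4⟩ := orbitCount_facts n₂ h₂ α₂ hinv₂ hfree₂ S₂ᶜ (hc α₂ hinv₂ _ hS₂)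
    have t1 := Set.ncard_add_ncard_compl S₁
    have t2 := Set.ncard_add_ncard_compl S₂
    rw [Nat.card_zmod] at t1 t2
    unfold pdGenus
    omega
  refine ⟨hgenus, ?_⟩
  have : NeZero (2 * n₁) := ⟨by omega⟩
  have : NeZero (2 * n₂) := ⟨by omega⟩
  have : NeZero (2 * (n₁ + n₂)) := ⟨by omega⟩
  unfold pdPoly
  rw [Finset.sum_mul_sum, ← Finset.sum_product', Finset.univ_product_univ]
  let J := Equiv.ofBijective _ hbij
  refine Fintype.sum_equiv
    ((Equiv.finsetCongr J.symm).trans Finset.sumEquiv.toEquiv) _ _ ?_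
  intro S
  have hm1 : ∀ x, x ∈ (((Equiv.finsetCongr J.symm).trans Finset.sumEquiv.toEquiv) S).1 ↔
      joinF n₁ n₂ (Sum.inl x) ∈ S := by
    intro x
    change x ∈ (Finset.map J.symm.toEmbedding S).toLeft ↔ J (Sum.inl x) ∈ S
    rw [Finset.mem_toLeft, Finset.mem_map_equiv, Equiv.symm_symm]
  have hm2 : ∀ x, x ∈ (((Equiv.finsetCongr J.symm).trans Finset.sumEquiv.toEquiv) S).2 ↔
      joinF n₁ n₂ (Sum.inr x) ∈ S := by
    intro x
    change x ∈ (Finset.map J.symm.toEmbedding S).toRight ↔ J (Sum.inr x) ∈ S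
    rw [Finset.mem_toRight, Finset.mem_map_equiv, Equiv.symm_symm]
  generalize ((Equiv.finsetCongr J.symm).trans Finset.sumEquiv.toEquiv) S = P at *
  obtain ⟨S₁, S₂⟩ := P
  simp only at hm1 hm2 ⊢
  by_cases hS : ∀ x ∈ S, α x ∈ S
  · have i1 : ∀ x ∈ S₁, α₁ x ∈ S₁ := by
      intro x hx
      rw [hm1] at hx ⊢
      have := hS _ hx
      rwa [hα] at this
    have i2 : ∀ x ∈ S₂, α₂ x ∈ S₂ := by
      intro x hx
      rw [hm2] at hx ⊢
      have := hS _ hx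
      rwa [hα] at this
    rw [if_pos hS, if_pos i1, if_pos i2, ← pow_add, hgenus _ hS]
    congr 3
    · ext x; exact (hm1 x).symm
    · ext x; exact (hm2 x).symm
  · rw [if_neg hS]
    by_cases i1 : ∀ x ∈ S₁, α₁ x ∈ S₁
    · by_cases i2 : ∀ x ∈ S₂, α₂ x ∈ S₂
      · exfalso
        apply hS
        intro x hx
        obtain ⟨t | t, rfl⟩ := hbij.2 x
        · rw [hα]; exact (hm1 _).1 (i1 _ ((hm1 _).2 hx))
        · rw [hα]; exact (hm2 _).1 (i2 _ ((hm2 _).2 hx))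
      · rw [if_neg i2, mul_zero]
    · rw [if_neg i1, zero_mul]
end

section
/- Let n ≥ 1 and let α be a chord diagram of order n in which no two chords interlace (a crossing-less matching, i.e. the chord diagram obtained from a plane tree with n edges by total duality). Then c(A) = |A| + 1 for every set A of chords, hence g(α, A) = 0 for all A (every partial dual has genus 0) and ∂Γ_α(z) = 2^n. -/
open scoped Classical

lemma cm_val_sub (n : ℕ) (hn : 1 ≤ n) (x y : ZMod (2 * n)) :
    (x.val ≤ y.val ∧ (y - x).val = y.val - x.val) ∨
    (y.val < x.val ∧ (y - x).val = y.val + 2 * n - x.val) := by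
  haveI : NeZero (2 * n) := ⟨by omega⟩
  have h := ZMod.val_add (y - x) x
  rw [sub_add_cancel] at h
  have h1 := ZMod.val_lt x
  have h2 := ZMod.val_lt y
  have h3 := ZMod.val_lt (y - x)
  rcases lt_or_ge ((y - x).val + x.val) (2 * n) with h4 | h4
  · rw [Nat.mod_eq_of_lt h4] at h
    left; omega
  · rw [Nat.mod_eq_sub_mod h4, Nat.mod_eq_of_lt (by omega)] at h
    right; omega

lemma cm_firstAfter (n : ℕ) (hn : 1 ≤ n) (S : Set (ZMod (2 * n))) (hS : S.Nonempty)
    (y : ZMod (2 * n)) :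
    firstAfter n S y ∈ S ∧
    ((y.val < (firstAfter n S y).val ∧
        ∀ s ∈ S, s.val ≤ y.val ∨ (firstAfter n S y).val ≤ s.val) ∨
     ((firstAfter n S y).val ≤ y.val ∧
        ∀ s ∈ S, s.val ≤ y.val ∧ (firstAfter n S y).val ≤ s.val)) := by
  haveI : NeZero (2 * n) := ⟨by omega⟩
  have key : ∀ s ∈ S, ∃ j : ℕ, 0 < j ∧ y + (j : ZMod (2 * n)) ∈ S ∧
      ((y.val < s.val ∧ j = s.val - y.val) ∨ (s.val ≤ y.val ∧ j = s.val + 2 * n - y.val)) := by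
    intro s hs
    have h1 := ZMod.val_lt s
    have h2 := ZMod.val_lt y
    rcases lt_or_ge y.val s.val with h | h
    · refine ⟨s.val - y.val, by omega, ?_, Or.inl ⟨h, rfl⟩⟩
      rw [Nat.cast_sub h.le]
      simpa using hs
    · refine ⟨s.val + 2 * n - y.val, by omega, ?_, Or.inr ⟨h, rfl⟩⟩
      rw [Nat.cast_sub (by omega), Nat.cast_add, ZMod.natCast_self]
      simpa using hs
  have hex : ∃ k : ℕ, 0 < k ∧ y + (k : ZMod (2 * n)) ∈ S := by
    obtain ⟨s, hs⟩ := hS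
    obtain ⟨j, h1, h2, _⟩ := key s hs
    exact ⟨j, h1, h2⟩
  have hdef : firstAfter n S y = y + (Nat.find hex : ZMod (2 * n)) := by
    unfold firstAfter
    rw [dif_pos hex]
  have hk := Nat.find_spec hex
  have hmin : ∀ s ∈ S, (y.val < s.val ∧ Nat.find hex ≤ s.val - y.val) ∨
      (s.val ≤ y.val ∧ Nat.find hex ≤ s.val + 2 * n - y.val) := by
    intro s hs
    obtain ⟨j, h1, h2, h3⟩ := key s hs
    have := Nat.find_min' hex ⟨h1, h2⟩
    omega
  rw [← hdef] at hk
  generalize hz : firstAfter n S y = z at *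
  generalize Nat.find hex = k at *
  have hkle : k ≤ 2 * n := by
    have h1 := ZMod.val_lt z
    have h2 := ZMod.val_lt y
    have := hmin z hk.2
    omega
  have hy := ZMod.val_lt y
  have hzl := ZMod.val_lt z
  have hv : z.val = (y.val + k) % (2 * n) := by
    rw [hdef, ZMod.val_add, ZMod.val_natCast, Nat.add_mod_mod]
  refine ⟨hk.2, ?_⟩
  rcases lt_or_ge (y.val + k) (2 * n) with h4 | h4
  · rw [Nat.mod_eq_of_lt h4] at hv
    left
    refine ⟨by omega, fun s hs => ?_⟩
    have := hmin s hs
    omega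
  · rw [Nat.mod_eq_sub_mod h4, Nat.mod_eq_of_lt (by omega)] at hv
    right
    refine ⟨by omega, fun s hs => ?_⟩
    have := hmin s hs
    have := ZMod.val_lt s
    omega

lemma cm_noncross (n : ℕ) (hn : 1 ≤ n)
    (α : Equiv.Perm (ZMod (2 * n)))
    (hinv : ∀ x, α (α x) = x)
    (hnocross : ∀ x y : ZMod (2 * n), (y ≠ x ∧ y ≠ α x) → ¬ Interlaces n α x y)
    (x y : ZMod (2 * n)) (hx : x.val < (α x).val) (h1 : y ≠ x) (h2 : y ≠ α x) :
    (x.val < y.val ∧ y.val < (α x).val ∧ x.val < (α y).val ∧ (α y).val < (α x).val) ∨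
    ((y.val < x.val ∨ (α x).val < y.val) ∧ ((α y).val < x.val ∨ (α x).val < (α y).val)) := by
  haveI : NeZero (2 * n) := ⟨by omega⟩
  have h := hnocross x y ⟨h1, h2⟩
  have e1 : y.val ≠ x.val := fun h => h1 (ZMod.val_injective _ h)
  have e2 : y.val ≠ (α x).val := fun h => h2 (ZMod.val_injective _ h)
  have e3 : (α y).val ≠ x.val := fun h => h2 (by
    rw [← ZMod.val_injective _ h, hinv])
  have e4 : (α y).val ≠ (α x).val := fun h => h1 (α.injective (ZMod.val_injective _ h))
  unfold Interlaces Xor' at h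
  try unfold Xor at h
  have a1 := cm_val_sub n hn x y
  have a2 := cm_val_sub n hn x (α x)
  have a3 := cm_val_sub n hn x (α y)
  have := ZMod.val_lt x
  have := ZMod.val_lt (α x)
  have := ZMod.val_lt y
  have := ZMod.val_lt (α y)
  omega

/-- closers -/
def cmClosers (n : ℕ) (α : Equiv.Perm (ZMod (2 * n))) (S : Set (ZMod (2 * n))) :
    Set (ZMod (2 * n)) := {x | x ∈ S ∧ (α x).val < x.val}

lemma cm_invariant (n : ℕ) (hn : 1 ≤ n)
    (α : Equiv.Perm (ZMod (2 * n)))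
    (hinv : ∀ x, α (α x) = x)
    (hnocross : ∀ x y : ZMod (2 * n), (y ≠ x ∧ y ≠ α x) → ¬ Interlaces n α x y)
    (S : Set (ZMod (2 * n))) (hS : ∀ x ∈ S, α x ∈ S)
    (q : ZMod (2 * n)) (hq : q ∈ cmClosers n α S) (x y : ZMod (2 * n))
    (h : Relation.EqvGen (boundaryStep n α S) x y) :
    ((α q).val < x.val ∧ x.val ≤ q.val) ↔ ((α q).val < y.val ∧ y.val ≤ q.val) := by
  haveI : NeZero (2 * n) := ⟨by omega⟩
  induction h with
  | refl => rfl
  | symm _ _ _ ih => exact ih.symm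
  | trans _ _ _ _ _ ih1 ih2 => exact ih1.trans ih2
  | rel x y h =>
    obtain ⟨hx, rfl⟩ := h
    obtain ⟨hqS, hlt⟩ := hq
    have hf := cm_firstAfter n hn S ⟨q, hqS⟩ (α x)
    generalize firstAfter n S (α x) = z at *
    obtain ⟨hzS, hf⟩ := hf
    have f1 : (α x).val < z.val ∧ (q.val ≤ (α x).val ∨ z.val ≤ q.val) ∧
        ((α q).val ≤ (α x).val ∨ z.val ≤ (α q).val) ∨
      z.val ≤ (α x).val ∧ (q.val ≤ (α x).val ∧ z.val ≤ q.val) ∧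
        ((α q).val ≤ (α x).val ∧ z.val ≤ (α q).val) := by
      rcases hf with ⟨h1, h2⟩ | ⟨h1, h2⟩
      · exact Or.inl ⟨h1, h2 q hqS, h2 _ (hS q hqS)⟩
      · exact Or.inr ⟨h1, h2 q hqS, h2 _ (hS q hqS)⟩
    clear hf
    by_cases c1 : x = q
    · subst c1; omega
    by_cases c2 : x = α q
    · subst c2; rw [hinv] at f1; omega
    have := cm_noncross n hn α hinv hnocross (α q) x (by rw [hinv]; exact hlt) c2
      (by rw [hinv]; exact c1)
    rw [hinv] at this
    omega

lemma cm_reach (n : ℕ) (hn : 1 ≤ n)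
    (α : Equiv.Perm (ZMod (2 * n)))
    (hfree : ∀ x, α x ≠ x)
    (S : Set (ZMod (2 * n))) (hS : ∀ x ∈ S, α x ∈ S)
    (m : ZMod (2 * n)) (hm : m ∈ S) (hmin : ∀ s ∈ S, m.val ≤ s.val) (k : ℕ) :
    ∀ x ∈ S, 2 * n ≤ x.val + k →
    ∃ y ∈ insert m (cmClosers n α S), Relation.EqvGen (boundaryStep n α S) x y := by
  haveI : NeZero (2 * n) := ⟨by omega⟩
  induction k with
  | zero => intro x _ h; have := ZMod.val_lt x; omega
  | succ k ih =>
    intro x hx h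
    rcases lt_trichotomy (α x).val x.val with h1 | h1 | h1
    · exact ⟨x, Or.inr ⟨hx, h1⟩, Relation.EqvGen.refl _⟩
    · exact absurd (ZMod.val_injective _ h1) (hfree x)
    · have hf := cm_firstAfter n hn S ⟨x, hx⟩ (α x)
      have hstep : Relation.EqvGen (boundaryStep n α S) x (firstAfter n S (α x)) :=
        Relation.EqvGen.rel _ _ ⟨hx, rfl⟩
      generalize firstAfter n S (α x) = z at *
      rcases hf with ⟨hz, ⟨h2, _⟩ | ⟨_, h3⟩⟩
      · obtain ⟨y, hy, hy2⟩ := ih z hz (by omega)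
        exact ⟨y, hy, hstep.trans _ _ _ hy2⟩
      · have : z = m := ZMod.val_injective _ (le_antisymm (h3 m hm).2 (hmin z hz))
        exact ⟨m, Or.inl rfl, this ▸ hstep⟩

lemma cm_closers_ncard (n : ℕ) (hn : 1 ≤ n)
    (α : Equiv.Perm (ZMod (2 * n)))
    (hinv : ∀ x, α (α x) = x) (hfree : ∀ x, α x ≠ x)
    (S : Set (ZMod (2 * n))) (hS : ∀ x ∈ S, α x ∈ S) :
    S.ncard = 2 * (cmClosers n α S).ncard := by
  haveI : NeZero (2 * n) := ⟨by omega⟩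
  have hU : S = cmClosers n α S ∪ α '' cmClosers n α S := by
    ext x
    constructor
    · intro hx
      rcases lt_trichotomy (α x).val x.val with h1 | h1 | h1
      · exact Or.inl ⟨hx, h1⟩
      · exact absurd (ZMod.val_injective _ h1) (hfree x)
      · exact Or.inr ⟨α x, ⟨hS x hx, by rwa [hinv]⟩, hinv x⟩
    · rintro (h | ⟨y, hy, rfl⟩)
      · exact h.1
      · exact hS y hy.1
  have hd : Disjoint (cmClosers n α S) (α '' cmClosers n α S) := by
    rw [Set.disjoint_left]
    rintro _ h ⟨y, hy, rfl⟩
    have h1 := h.2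
    have h2 := hy.2
    rw [hinv] at h1
    omega
  conv_lhs => rw [hU]
  rw [Set.ncard_union_eq hd (Set.toFinite _) (Set.toFinite _),
    Set.ncard_image_of_injective _ α.injective]
  ring

lemma cm_orbitCount (n : ℕ) (hn : 1 ≤ n)
    (α : Equiv.Perm (ZMod (2 * n)))
    (hinv : ∀ x, α (α x) = x) (hfree : ∀ x, α x ≠ x)
    (hnocross : ∀ x y : ZMod (2 * n), (y ≠ x ∧ y ≠ α x) → ¬ Interlaces n α x y)
    (S : Set (ZMod (2 * n))) (hS : ∀ x ∈ S, α x ∈ S) :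
    orbitCount n α S = (cmClosers n α S).ncard + 1 := by
  haveI : NeZero (2 * n) := ⟨by omega⟩
  unfold orbitCount
  split_ifs with he
  · have : cmClosers n α S = ∅ := by
      ext x; simp [cmClosers, he]
    simp [this]
  obtain ⟨m, hm, hmin⟩ := Set.exists_min_image S ZMod.val (Set.toFinite _)
    (Set.nonempty_iff_ne_empty.mpr he)
  have hmC : m ∉ cmClosers n α S := by
    intro h
    have h1 := h.2
    have := hmin _ (hS m hm)
    omega
  have himg : (fun x => {y | Relation.EqvGen (boundaryStep n α S) x y}) '' S =
      (fun x => {y | Relation.EqvGen (boundaryStep n α S) x y}) ''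
        insert m (cmClosers n α S) := by
    apply Set.Subset.antisymm
    · rintro _ ⟨x, hx, rfl⟩
      obtain ⟨y, hy, hxy⟩ := cm_reach n hn α hfree S hS m hm hmin (2 * n) x hx (by omega)
      refine ⟨y, hy, ?_⟩
      ext w
      exact ⟨fun h => hxy.trans _ _ _ h, fun h => (hxy.symm _ _).trans _ _ _ h⟩
    · apply Set.image_mono
      rintro x (rfl | h)
      · exact hm
      · exact h.1
  rw [himg, Set.ncard_image_of_injOn, Set.ncard_insert_of_notMem hmC (Set.toFinite _)]
  have hcl : ∀ x ∈ cmClosers n α S, ∀ y,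
      Relation.EqvGen (boundaryStep n α S) x y → (α x).val < y.val ∧ y.val ≤ x.val := by
    intro x hx y h
    exact (cm_invariant n hn α hinv hnocross S hS x hx x y h).1 ⟨hx.2, le_rfl⟩
  intro x hx y hy hxy
  have hR : Relation.EqvGen (boundaryStep n α S) x y := by
    have : y ∈ {w | Relation.EqvGen (boundaryStep n α S) x w} := by
      have h2 : {w | Relation.EqvGen (boundaryStep n α S) x w} =
        {w | Relation.EqvGen (boundaryStep n α S) y w} := hxy
      rw [h2]; exact Relation.EqvGen.refl _
    exact this
  rcases hx with rfl | hx <;> rcases hy with rfl | hy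
  · rfl
  · have := hcl y hy _ (hR.symm _ _)
    have := hmin _ (hS y hy.1)
    omega
  · have := hcl x hx _ hR
    have := hmin _ (hS x hx.1)
    omega
  · have h1 := hcl y hy _ (hR.symm _ _)
    have h2 := hcl x hx _ hR
    exact ZMod.val_injective _ (by omega)

lemma cm_count (n : ℕ) (hn : 1 ≤ n) [NeZero (2 * n)]
    (α : Equiv.Perm (ZMod (2 * n)))
    (hinv : ∀ x, α (α x) = x) (hfree : ∀ x, α x ≠ x) :
    (Finset.univ.filter (fun S : Finset (ZMod (2 * n)) => ∀ x ∈ S, α x ∈ S)).card = 2 ^ n := by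
  set C : Finset (ZMod (2 * n)) := Finset.univ.filter (fun x => (α x).val < x.val) with hC
  have hCn : C.card = n := by
    have h := cm_closers_ncard n hn α hinv hfree Set.univ (fun _ _ => Set.mem_univ _)
    have h2 : cmClosers n α Set.univ = (C : Set (ZMod (2 * n))) := by
      ext x; simp [cmClosers, hC]
    rw [h2, Set.ncard_coe_finset, Set.ncard_univ, Nat.card_zmod] at h
    omega
  have hmem : ∀ x, x ∈ C ↔ (α x).val < x.val := by simp [hC]
  have hor : ∀ x, x ∉ C ↔ α x ∈ C := by
    intro x
    rw [hmem, hmem, hinv]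
    have : (α x).val ≠ x.val := fun h => hfree x (ZMod.val_injective _ h)
    omega
  have hP : C.powerset.card = 2 ^ n := by rw [Finset.card_powerset, hCn]
  rw [← hP]
  refine Finset.card_bij' (fun S _ => S ∩ C) (fun B _ => B ∪ B.image α) ?_ ?_ ?_ ?_
  · intro S _
    simp
  · intro B _
    simp only [Finset.mem_filter, Finset.mem_univ, true_and, Finset.mem_union, Finset.mem_image]
    rintro x (h | ⟨y, hy, rfl⟩)
    · exact Or.inr ⟨x, h, rfl⟩
    · left; rwa [hinv]
  · intro S hS
    simp only [Finset.mem_filter, Finset.mem_univ, true_and] at hS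
    ext x
    simp only [Finset.mem_union, Finset.mem_image, Finset.mem_inter]
    constructor
    · rintro (h | ⟨y, hy, rfl⟩)
      · exact h.1
      · exact hS y hy.1
    · intro hx
      by_cases h : x ∈ C
      · exact Or.inl ⟨hx, h⟩
      · exact Or.inr ⟨α x, ⟨hS x hx, (hor x).1 h⟩, hinv x⟩
  · intro B hB
    rw [Finset.mem_powerset] at hB
    ext x
    simp only [Finset.mem_union, Finset.mem_image, Finset.mem_inter]
    constructor
    · rintro ⟨h | ⟨y, hy, rfl⟩, h2⟩
      · exact h
      · have := (hor (α y)).2 (by rw [hinv]; exact hB hy)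
        exact absurd h2 this
    · intro h
      exact ⟨Or.inl h, hB h⟩

/-- If no two chords of `α` interlace (a crossing-less matching, i.e. the total dual of a
plane tree with `n` edges), then `c(A) = |A| + 1` for every set `A` of chords, hence every
partial dual has genus `0` and `∂Γ_α(z) = 2^n`. -/
theorem crossingless_matching_genus_zero (n : ℕ) (hn : 1 ≤ n)
    (α : Equiv.Perm (ZMod (2 * n)))
    (hinv : ∀ x, α (α x) = x) (hfree : ∀ x, α x ≠ x)
    (hnocross : ∀ x y : ZMod (2 * n), (y ≠ x ∧ y ≠ α x) → ¬ Interlaces n α x y) :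
    (∀ S : Set (ZMod (2 * n)), (∀ x ∈ S, α x ∈ S) →
      orbitCount n α S = S.ncard / 2 + 1) ∧
    (∀ S : Set (ZMod (2 * n)), (∀ x ∈ S, α x ∈ S) → pdGenus n α S = 0) ∧
    pdPoly n (by omega) α = Polynomial.C ((2 : ℕ) ^ n) := by
  have A : ∀ S : Set (ZMod (2 * n)), (∀ x ∈ S, α x ∈ S) →
      orbitCount n α S = S.ncard / 2 + 1 := by
    intro S hS
    rw [cm_orbitCount n hn α hinv hfree hnocross S hS,
      cm_closers_ncard n hn α hinv hfree S hS]
    omega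
  have B : ∀ S : Set (ZMod (2 * n)), (∀ x ∈ S, α x ∈ S) → pdGenus n α S = 0 := by
    intro S hS
    haveI : NeZero (2 * n) := ⟨by omega⟩
    have hSc : ∀ x ∈ Sᶜ, α x ∈ Sᶜ := by
      intro x hx h
      exact hx (by simpa [hinv] using hS _ h)
    have h1 := cm_closers_ncard n hn α hinv hfree S hS
    have h2 := cm_closers_ncard n hn α hinv hfree Sᶜ hSc
    have h3 := Set.ncard_add_ncard_compl S
    rw [Nat.card_zmod] at h3
    unfold pdGenus
    rw [A S hS, A _ hSc]
    omega
  refine ⟨A, B, ?_⟩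
  haveI : NeZero (2 * n) := ⟨by omega⟩
  unfold pdPoly
  rw [← cm_count n hn α hinv hfree, Finset.card_filter, map_sum]
  refine Finset.sum_congr rfl fun S _ => ?_
  split_ifs with h
  · rw [B S (by simpa using h)]
    simp
  · simp
end

section
/- Let n ≥ 1 and let α be a chord diagram of order n. The interlacement graph of α is connected if and only if α is join-prime, i.e. there is no cyclic interval I = {a + 1, a + 2, …, a + k} in ZMod (2n) with a ∈ ZMod (2n), 2 ≤ k ≤ 2n − 2, and α(I) = I (such an invariant interval is exactly a decomposition of the one-vertex ribbon graph of α as a ribbon-join of two ribbon graphs each having at least one edge). -/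
open scoped Classical

theorem aux_val_sub (N : ℕ) [NeZero N] (e x y : ZMod N) :
    (y - x).val = if (x - e).val ≤ (y - e).val then (y - e).val - (x - e).val
      else (y - e).val + N - (x - e).val := by
  have h : y - x = (y - e) - (x - e) := by ring
  have h1 := ZMod.val_lt (x - e)
  have h2 := ZMod.val_lt (y - e)
  rw [h]
  split_ifs with hc
  · exact ZMod.val_sub hc
  · have h' : (y - e) - (x - e) = -((x - e) - (y - e)) := by ring
    have h3 : ((x - e) - (y - e)).val = (x - e).val - (y - e).val := ZMod.val_sub (by omega)
    rw [h', ZMod.neg_val, h3]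
    split_ifs with h0
    · rw [h0, ZMod.val_zero] at h3
      omega
    · omega

theorem aux_pos_inj (N : ℕ) [NeZero N] (e x y : ZMod N) :
    (x - e).val = (y - e).val ↔ x = y := by
  constructor
  · intro h
    have := ZMod.val_injective N h
    simpa using this
  · rintro rfl; rfl

theorem aux_interlaces (n : ℕ) (hn : 1 ≤ n) (α : Equiv.Perm (ZMod (2 * n)))
    (hinv : ∀ x, α (α x) = x) (hfree : ∀ x, α x ≠ x) (e x y : ZMod (2 * n)) :
    Interlaces n α x y ↔
    Xor' (min (x - e).val (α x - e).val < (y - e).val ∧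
        (y - e).val < max (x - e).val (α x - e).val)
      (min (x - e).val (α x - e).val < (α y - e).val ∧
        (α y - e).val < max (x - e).val (α x - e).val) := by
  haveI : NeZero (2 * n) := ⟨by omega⟩
  unfold Interlaces
  rw [aux_val_sub (2 * n) e x y, aux_val_sub (2 * n) e x (α x), aux_val_sub (2 * n) e x (α y)]
  have a1 := mt (aux_pos_inj (2 * n) e (α x) x).1 (hfree x)
  have a2 := mt (aux_pos_inj (2 * n) e (α y) y).1 (hfree y)
  have a3 : (y - e).val = (x - e).val ↔ (α y - e).val = (α x - e).val := by
    rw [aux_pos_inj, aux_pos_inj, α.injective.eq_iff]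
  have a4 : (y - e).val = (α x - e).val ↔ (α y - e).val = (x - e).val := by
    rw [aux_pos_inj, aux_pos_inj]
    constructor
    · rintro rfl; exact hinv x
    · intro h; rw [← h, hinv]
  have b1 := ZMod.val_lt (x - e)
  have b2 := ZMod.val_lt (y - e)
  have b3 := ZMod.val_lt (α x - e)
  have b4 := ZMod.val_lt (α y - e)
  generalize (x - e).val = X at *
  generalize (y - e).val = Y at *
  generalize (α x - e).val = A at *
  generalize (α y - e).val = B at *
  simp only [Xor', xor_def]
  rcases Nat.lt_or_gt_of_ne a1 with h | h
  · rw [min_eq_right h.le, max_eq_left h.le]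
    split_ifs <;> omega
  · rw [min_eq_left h.le, max_eq_right h.le]
    split_ifs <;> omega

/-- The chord through a point. -/
def auxChord (n : ℕ) (α : Equiv.Perm (ZMod (2 * n))) (x : ZMod (2 * n)) :
    {p : Sym2 (ZMod (2 * n)) // ∃ x, p = s(x, α x)} := ⟨s(x, α x), x, rfl⟩

theorem auxChord_alpha (n : ℕ) (α : Equiv.Perm (ZMod (2 * n)))
    (hinv : ∀ x, α (α x) = x) (x : ZMod (2 * n)) : auxChord n α (α x) = auxChord n α x := by
  apply Subtype.ext
  simp only [auxChord, hinv]
  exact Sym2.eq_swap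

theorem aux_reach (n : ℕ) (α : Equiv.Perm (ZMod (2 * n))) (x y : ZMod (2 * n))
    (h : Interlaces n α x y) :
    (interGraph n α).Reachable (auxChord n α x) (auxChord n α y) := by
  by_cases hc : auxChord n α x = auxChord n α y
  · rw [hc]
  · apply SimpleGraph.Adj.reachable
    unfold interGraph
    rw [SimpleGraph.fromRel_adj]
    exact ⟨hc, Or.inl ⟨x, y, rfl, rfl, h⟩⟩

theorem aux_pred (n : ℕ) (α : Equiv.Perm (ZMod (2 * n)))
    (hinv : ∀ x, α (α x) = x) (P : ZMod (2 * n) → Prop)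
    (h1 : ∀ x, P x → P (α x)) (h2 : ∀ x y, Interlaces n α x y → (P x ↔ P y))
    (x y : ZMod (2 * n))
    (h : (interGraph n α).Reachable (auxChord n α x) (auxChord n α y)) : P x → P y := by
  have h1' : ∀ x, P x ↔ P (α x) := fun x => ⟨h1 x, fun h => by simpa [hinv] using h1 _ h⟩
  have key : ∀ u v : ZMod (2 * n), s(u, α u) = s(v, α v) → (P u ↔ P v) := by
    intro u v huv
    rw [Sym2.eq_iff] at huv
    rcases huv with ⟨h, _⟩ | ⟨h, _⟩
    · rw [h]
    · rw [h, ← h1']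
  obtain ⟨w⟩ := h
  have main : ∀ c d, (interGraph n α).Walk c d → ∀ u v, c.1 = s(u, α u) → d.1 = s(v, α v) →
      (P u ↔ P v) := by
    intro c d w
    induction w with
    | nil =>
      intro u v hu hv
      exact key u v (hu.symm.trans hv)
    | @cons a b c hab w ih =>
      intro u v hu hv
      unfold interGraph at hab
      rw [SimpleGraph.fromRel_adj] at hab
      rcases hab.2 with ⟨p, q, hp, hq, hi⟩ | ⟨p, q, hp, hq, hi⟩
      · exact (key u p (hu.symm.trans hp)).trans ((h2 p q hi).trans (ih q v hq hv))
      · exact (key u q (hu.symm.trans hq)).trans ((h2 p q hi).symm.trans (ih p v hp hv))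
  exact (main _ _ w x y rfl rfl).1

theorem aux_interval (n : ℕ) (hn : 1 ≤ n) (e : ZMod (2 * n)) (l k : ℕ) (hk : l + k < 2 * n)
    (y : ZMod (2 * n)) :
    (∃ i : ℕ, 1 ≤ i ∧ i ≤ k ∧ y = e + (l : ZMod (2 * n)) + (i : ZMod (2 * n))) ↔
      l < (y - e).val ∧ (y - e).val ≤ l + k := by
  haveI : NeZero (2 * n) := ⟨by omega⟩
  constructor
  · rintro ⟨i, h1, h2, rfl⟩
    have : e + (l : ZMod (2 * n)) + (i : ZMod (2 * n)) - e = ((l + i : ℕ) : ZMod (2 * n)) := by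
      push_cast; ring
    rw [this, ZMod.val_natCast_of_lt (by omega)]
    omega
  · rintro ⟨h1, h2⟩
    refine ⟨(y - e).val - l, by omega, by omega, ?_⟩
    rw [add_assoc, ← Nat.cast_add, Nat.add_sub_cancel' h1.le, ZMod.natCast_zmod_val]
    ring

theorem aux_forward (n : ℕ) (hn : 1 ≤ n) (α : Equiv.Perm (ZMod (2 * n)))
    (hinv : ∀ x, α (α x) = x) (hfree : ∀ x, α x ≠ x)
    (hc : (interGraph n α).Connected) (a : ZMod (2 * n)) (k : ℕ) (hk : 2 ≤ k)
    (hk2 : k ≤ 2 * n - 2)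
    (h : ∀ y, (0 < (y - a).val ∧ (y - a).val ≤ k) →
      (0 < (α y - a).val ∧ (α y - a).val ≤ k)) : False := by
  haveI : NeZero (2 * n) := ⟨by omega⟩
  have h' : ∀ y, (0 < (y - a).val ∧ (y - a).val ≤ k) ↔
      (0 < (α y - a).val ∧ (α y - a).val ≤ k) :=
    fun y => ⟨h y, fun hh => by simpa [hinv] using h _ hh⟩
  have := aux_pred n α hinv (fun y => 0 < (y - a).val ∧ (y - a).val ≤ k) h ?_ (a + 1) a
    (hc.preconnected _ _) ?_
  · simp at this
  · intro x y hi
    rw [aux_interlaces n hn α hinv hfree a] at hi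
    have hx := h' x
    have hy := h' y
    have b1 := ZMod.val_lt (x - a)
    have b2 := ZMod.val_lt (y - a)
    show (0 < (x - a).val ∧ (x - a).val ≤ k) ↔ (0 < (y - a).val ∧ (y - a).val ≤ k)
    simp only [Xor', xor_def] at hi
    omega
  · have : a + 1 - a = ((1 : ℕ) : ZMod (2 * n)) := by push_cast; ring
    show 0 < (a + 1 - a).val ∧ (a + 1 - a).val ≤ k
    rw [this, ZMod.val_natCast_of_lt (by omega)]
    omega

theorem aux_backward (n : ℕ) (hn : 1 ≤ n) (α : Equiv.Perm (ZMod (2 * n)))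
    (hinv : ∀ x, α (α x) = x) (hfree : ∀ x, α x ≠ x) (e x0 : ZMod (2 * n))
    (hc : ¬ (interGraph n α).Reachable (auxChord n α e) (auxChord n α x0)) :
    ∃ l k : ℕ, l + k < 2 * n ∧ 2 ≤ k ∧ k ≤ 2 * n - 2 ∧
      ∀ y, (l < (y - e).val ∧ (y - e).val ≤ l + k) →
      (l < (α y - e).val ∧ (α y - e).val ≤ l + k) := by
  haveI : NeZero (2 * n) := ⟨by omega⟩
  set S : ZMod (2 * n) → Prop :=
    fun x => (interGraph n α).Reachable (auxChord n α e) (auxChord n α x) with hS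
  have he : S e := SimpleGraph.Reachable.refl _
  have hx0 : ¬ S x0 := hc
  have hSα : ∀ x, S (α x) ↔ S x := by
    intro x
    simp only [hS, auxChord_alpha n α hinv]
  have hSi : ∀ x y, Interlaces n α x y → (S x ↔ S y) := by
    intro x y hi
    have := aux_reach n α x y hi
    exact ⟨fun h => h.trans this, fun h => h.trans this.symm⟩
  have hreach : ∀ y, S y → (interGraph n α).Reachable (auxChord n α e) (auxChord n α y) :=
    fun y h => h
  clear_value S
  have hpe : (e - e).val = 0 := by simp
  -- separation
  have hsep : ∀ x y, ¬ S x → S y →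
      ¬ (min (x - e).val (α x - e).val < (y - e).val ∧
        (y - e).val < max (x - e).val (α x - e).val) := by
    intro x y hx hy hin
    have := aux_pred n α hinv (fun z => S z ∧ ¬ (min (x - e).val (α x - e).val < (z - e).val ∧
        (z - e).val < max (x - e).val (α x - e).val)) ?_ ?_ e y (hreach y hy) ?_
    · exact this.2 hin
    · rintro z ⟨hz, hz2⟩
      refine ⟨(hSα z).2 hz, fun hh => ?_⟩
      exact hx ((hSi x z ((aux_interlaces n hn α hinv hfree e x z).2 (Or.inr ⟨hh, hz2⟩))).2 hz)
    · intro u v hi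
      have hSuv := hSi u v hi
      by_cases hu : S u
      · have hv := hSuv.1 hu
        have n1 : ¬ Interlaces n α x u := fun h => hx ((hSi x u h).2 hu)
        have n2 : ¬ Interlaces n α x v := fun h => hx ((hSi x v h).2 hv)
        rw [aux_interlaces n hn α hinv hfree e] at n1 n2 hi
        have i1 : ∀ w, S w → (w - e).val ≠ (x - e).val := fun w hw hh => by
          rw [aux_pos_inj] at hh; exact hx (hh ▸ hw)
        have i2 : ∀ w, S w → (w - e).val ≠ (α x - e).val := fun w hw hh => by
          rw [aux_pos_inj] at hh; exact hx ((hSα x).1 (hh ▸ hw))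
        have j1 := i1 u hu
        have j2 := i1 v hv
        have j3 := i2 u hu
        have j4 := i2 v hv
        have j5 := i1 _ ((hSα u).2 hu)
        have j6 := i1 _ ((hSα v).2 hv)
        have j7 := i2 _ ((hSα u).2 hu)
        have j8 := i2 _ ((hSα v).2 hv)
        simp only [hu, hv, true_and]
        simp only [Xor', xor_def] at n1 n2 hi
        clear * - n1 n2 hi j1 j2 j3 j4 j5 j6 j7 j8
        generalize (x - e).val = X at *
        generalize (α x - e).val = A at *
        have : min X A ≤ max X A := by omega
        have : (X = min X A ∧ A = max X A) ∨ (A = min X A ∧ X = max X A) := by omega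
        generalize min X A = L at *
        generalize max X A = R at *
        omega
      · simp [hu, mt hSuv.2 hu]
    · refine ⟨he, ?_⟩
      rw [hpe]; omega
  -- the gap
  have hpt : ∀ m : ℕ, m < 2 * n → (e + (m : ZMod (2 * n)) - e).val = m := by
    intro m hm
    rw [add_sub_cancel_left, ZMod.val_natCast_of_lt hm]
  have hpt2 : ∀ y : ZMod (2 * n), e + ((y - e).val : ZMod (2 * n)) = y := by
    intro y
    rw [ZMod.natCast_zmod_val]; ring
  set T : ℕ → Prop := fun m => S (e + (m : ZMod (2 * n))) with hT
  have hTS : ∀ y, T (y - e).val ↔ S y := by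
    intro y
    simp only [hT, hpt2]
  have hT0 : T 0 := by simpa [hT] using he
  have hTN : T (2 * n) := by
    have : ((2 * n : ℕ) : ZMod (2 * n)) = 0 := ZMod.natCast_self _
    simp only [hT, this, add_zero]; exact he
  have hTx0 : ¬ T (x0 - e).val := by rw [hTS]; exact hx0
  have hx0lt := ZMod.val_lt (x0 - e)
  obtain ⟨l, hl, hlT, hlmax⟩ : ∃ l, l < (x0 - e).val ∧ T l ∧
      ∀ m, l < m → m ≤ (x0 - e).val → ¬ T m := by
    refine ⟨Nat.findGreatest T (x0 - e).val, ?_, ?_, ?_⟩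
    · refine lt_of_le_of_ne (Nat.findGreatest_le _) fun h => hTx0 ?_
      have := Nat.findGreatest_spec (P := T) (Nat.zero_le (x0 - e).val) hT0
      rwa [h] at this
    · exact Nat.findGreatest_spec (P := T) (Nat.zero_le (x0 - e).val) hT0
    · intro m h1 h2
      exact Nat.findGreatest_is_greatest h1 h2
  have hex : ∃ r, (x0 - e).val < r ∧ T r := ⟨2 * n, hx0lt, hTN⟩
  obtain ⟨r, hr, hrT, hrmin, hrN⟩ : ∃ r, (x0 - e).val < r ∧ T r ∧
      (∀ m, m < r → (x0 - e).val < m → ¬ T m) ∧ r ≤ 2 * n := by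
    refine ⟨Nat.find hex, (Nat.find_spec hex).1, (Nat.find_spec hex).2, ?_, ?_⟩
    · intro m h1 h2 h3
      exact Nat.find_min hex h1 ⟨h2, h3⟩
    · exact Nat.find_min' hex ⟨hx0lt, hTN⟩
  have hgap : ∀ m, l < m → m < r → ¬ T m := by
    intro m h1 h2
    rcases le_or_gt m (x0 - e).val with h | h
    · exact hlmax m h1 h
    · exact hrmin m h2 h
  have hinvt : ∀ y, (l < (y - e).val ∧ (y - e).val < r) →
      (l < (α y - e).val ∧ (α y - e).val < r) := by
    rintro y ⟨h1, h2⟩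
    have hy : ¬ S y := by rw [← hTS]; exact hgap _ h1 h2
    have hay : ¬ S (α y) := by rwa [hSα]
    have hlne : (α y - e).val ≠ l := fun h => hay (by rw [← hTS, h]; exact hlT)
    have hrne : (α y - e).val ≠ r := fun h => hay (by rw [← hTS, h]; exact hrT)
    have hlt := ZMod.val_lt (α y - e)
    have s1 := hsep y _ hy hlT
    rw [hpt l (by omega)] at s1
    refine ⟨by omega, ?_⟩
    by_contra hcon
    have s2 := hsep y _ hy hrT
    rw [hpt r (by omega)] at s2
    omega
  have hx0i := hinvt x0 ⟨hl, hr⟩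
  have d1 := mt (aux_pos_inj (2 * n) e (α x0) x0).1 (hfree x0)
  have d2 := mt (aux_pos_inj (2 * n) e (α e) e).1 (hfree e)
  have d3 := ZMod.val_lt (α e - e)
  have d4 : ¬ (l < (α e - e).val ∧ (α e - e).val < r) := fun h =>
    hgap _ h.1 h.2 (by rw [hTS, hSα]; exact he)
  refine ⟨l, r - 1 - l, by omega, by omega, by omega, ?_⟩
  intro y hy
  have := hinvt y ⟨hy.1, by omega⟩
  omega

/-- The interlacement graph of a chord diagram `α` is connected if and only if `α` is
join-prime: there is no cyclic interval `I = {a + 1, …, a + k}` with `2 ≤ k ≤ 2n − 2`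
invariant under `α` (such an interval is exactly a decomposition of the one-vertex ribbon
graph of `α` as a ribbon-join of two ribbon graphs each having at least one edge). -/
theorem connected_iff_join_prime (n : ℕ) (hn : 1 ≤ n) (α : Equiv.Perm (ZMod (2 * n)))
    (hinv : ∀ x, α (α x) = x) (hfree : ∀ x, α x ≠ x) :
    (interGraph n α).Connected ↔
      ¬ ∃ (a : ZMod (2 * n)) (k : ℕ), 2 ≤ k ∧ k ≤ 2 * n - 2 ∧
        (⇑α) '' {y : ZMod (2 * n) | ∃ i : ℕ, 1 ≤ i ∧ i ≤ k ∧ y = a + (i : ZMod (2 * n))} =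
          {y : ZMod (2 * n) | ∃ i : ℕ, 1 ≤ i ∧ i ≤ k ∧ y = a + (i : ZMod (2 * n))} := by
  haveI : NeZero (2 * n) := ⟨by omega⟩
  constructor
  · rintro hc ⟨a, k, hk, hk2, him⟩
    refine aux_forward n hn α hinv hfree hc a k hk hk2 fun y hy => ?_
    have key := aux_interval n hn a 0 k (by omega)
    simp only [Nat.cast_zero, add_zero, zero_add] at key
    rw [← key] at hy ⊢
    have : α y ∈ (⇑α) '' {y : ZMod (2 * n) | ∃ i : ℕ, 1 ≤ i ∧ i ≤ k ∧
        y = a + (i : ZMod (2 * n))} := ⟨y, hy, rfl⟩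
    rw [him] at this
    exact this
  · intro hno
    haveI : Nonempty {p : Sym2 (ZMod (2 * n)) // ∃ x, p = s(x, α x)} := ⟨auxChord n α 0⟩
    refine ⟨?_⟩
    rintro ⟨_, e, rfl⟩ ⟨_, x0, rfl⟩
    by_contra hc
    obtain ⟨l, k, hlk, hk, hk2, h⟩ := aux_backward n hn α hinv hfree e x0 hc
    refine hno ⟨e + (l : ZMod (2 * n)), k, hk, hk2, ?_⟩
    ext y
    simp only [Set.mem_image, Set.mem_setOf_eq, aux_interval n hn e l k hlk]
    constructor
    · rintro ⟨x, hx, rfl⟩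
      exact h x hx
    · intro hy
      exact ⟨α y, h y hy, hinv y⟩
end

section
/- Let G = (Φ, s₀, s₁, s₂) be a connected gem (the subgroup generated by s₀, s₁, s₂ acts transitively on Φ), and let T ⊆ Φ be a union of edges which is a spanning tree of G: the number of edges contained in T equals V(G) − 1, and the equivalence relation on Φ generated by x ∼ s₁ x and x ∼ s₂ x for all x ∈ Φ, together with x ∼ s₀ x for x ∈ T, has a single equivalence class. Then the partial dual G^T has exactly one vertex: the subgroup generated by {s₁, s₂^T} acts transitively on Φ. (Hence every connected ribbon graph has a one-vertex partial dual.) -/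
open scoped Classical

/-- The equivalence relation on flags generated by `x ∼ f x` and `x ∼ g x`; its classes
are the orbits of the subgroup generated by the permutations `f` and `g`. -/
def genRel {Φ : Type*} (f g : Φ → Φ) : Φ → Φ → Prop :=
  Relation.EqvGen (fun x y => y = f x ∨ y = g x)

/-- The orbit (class) of a flag under the subgroup generated by `f` and `g`. -/
def genClass {Φ : Type*} (f g : Φ → Φ) (x : Φ) : Set Φ := {y | genRel f g x y}

/-- The number of orbits of the subgroup generated by `f` and `g` on the flags.
For a gem `(Φ, s₀, s₁, s₂)`: `V = genCount Φ s₁ s₂`, `E = genCount Φ s₀ s₂`,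
`F = genCount Φ s₀ s₁`. -/
noncomputable def genCount (Φ : Type*) (f g : Φ → Φ) : ℕ :=
  (Set.range (genClass f g)).ncard

/-- The map agreeing with `f` outside `A` and with `g` on `A`: the partial dual `G^A` of
the gem `(Φ, s₀, s₁, s₂)` is the gem `(Φ, pdMap s₀ s₂ A, s₁, pdMap s₂ s₀ A)`. -/
noncomputable def pdMap {Φ : Type*} (f g : Φ → Φ) (A : Set Φ) (x : Φ) : Φ :=
  if x ∈ A then g x else f x

/-- The genus `g = (2 − V + E − F)/2` of the gem with involutions `t₀, t₁, t₂`. -/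
noncomputable def gemGenus (Φ : Type*) (t₀ t₁ t₂ : Φ → Φ) : ℤ :=
  (2 - (genCount Φ t₁ t₂ : ℤ) + (genCount Φ t₀ t₂ : ℤ) - (genCount Φ t₀ t₁ : ℤ)) / 2


theorem eg_le {Φ : Type*} {r q : Φ → Φ → Prop} (hq : Equivalence q)
    (h : ∀ x y, r x y → q x y) {x y : Φ} (hxy : Relation.EqvGen r x y) : q x y := by
  induction hxy with
  | rel x y h' => exact h _ _ h'
  | refl x => exact hq.refl x
  | symm x y _ ih => exact hq.symm ih
  | trans x y z _ _ ih1 ih2 => exact hq.trans ih1 ih2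

theorem gr_equiv {Φ : Type*} (f g : Φ → Φ) : Equivalence (genRel f g) :=
  Relation.EqvGen.is_equivalence _

theorem gr_f {Φ : Type*} (f g : Φ → Φ) (x : Φ) : genRel f g x (f x) :=
  Relation.EqvGen.rel _ _ (Or.inl rfl)

theorem gr_g {Φ : Type*} (f g : Φ → Φ) (x : Φ) : genRel f g x (g x) :=
  Relation.EqvGen.rel _ _ (Or.inr rfl)

theorem even_aux {Φ : Type*} (C : Finset Φ) (f : Φ → Φ) (hf : ∀ x, f (f x) = x)
    (hff : ∀ x, f x ≠ x) (hC : ∀ x ∈ C, f x ∈ C) : ∑ _x ∈ C, (1 : ZMod 2) = 0 := by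
  refine Finset.sum_involution (fun a _ => f a) ?_ ?_ ?_ ?_
  · intros; decide
  · intro a _ _; exact hff a
  · intro a ha; exact hC a ha
  · intro a _; exact hf a

theorem path_aux {Φ : Type*} [Fintype Φ] (f g g' : Φ → Φ)
    (hf : ∀ x, f (f x) = x) (hff : ∀ x, f x ≠ x)
    (hg : ∀ x, g (g x) = x) (hgf : ∀ x, g x ≠ x)
    (a : Φ) (E : Set Φ) (h1 : ∀ y, y ∉ E → g' y = g y)
    (h2 : ∀ y ∈ E, genRel f g a y → y = a ∨ y = g a) : genRel f g' a (g a) := by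
  by_contra hcon
  let C : Finset Φ := Finset.univ.filter (fun y => genRel f g a y ∧ genRel f g' a y)
  have memC : ∀ y, y ∈ C ↔ genRel f g a y ∧ genRel f g' a y := by
    intro y; simp [C]
  have ha : a ∈ C := (memC a).2 ⟨(gr_equiv f g).refl a, (gr_equiv f g').refl a⟩
  have e1 := even_aux C f hf hff (by
    intro y hy
    rw [memC] at hy ⊢
    exact ⟨(gr_equiv f g).trans hy.1 (gr_f f g y), (gr_equiv f g').trans hy.2 (gr_f f g' y)⟩)
  have e2 := even_aux (C.erase a) g hg hgf (by
    intro y hy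
    rw [Finset.mem_erase, memC] at hy ⊢
    obtain ⟨hya, hy1, hy2⟩ := hy
    have hyg : y ≠ g a := by
      rintro rfl; exact hcon hy2
    have hyE : y ∉ E := by
      intro h
      rcases h2 y h hy1 with h | h
      · exact hya h
      · exact hyg h
    refine ⟨?_, (gr_equiv f g).trans hy1 (gr_g f g y), ?_⟩
    · intro h; apply hyg; rw [← h, hg]
    · have := (gr_equiv f g').trans hy2 (gr_g f g' y)
      rwa [h1 y hyE] at this)
  have := Finset.add_sum_erase C (fun _ => (1 : ZMod 2)) ha
  simp only [e1, e2] at this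
  exact absurd this (by decide)

theorem count_le {Φ : Type*} [Fintype Φ] (r r' : Setoid Φ)
    (h : ∀ u v, r' u v → r u v) :
    Nat.card (Quotient r) ≤ Nat.card (Quotient r') := by
  refine Nat.card_le_card_of_injective (fun q => (Quotient.mk r' q.out)) ?_
  intro p q hpq
  have := h _ _ (Quotient.exact hpq)
  rw [← Quotient.out_eq p, ← Quotient.out_eq q]
  exact Quotient.sound this

theorem count_le_succ {Φ : Type*} [Fintype Φ] (r r' : Setoid Φ) (x y : Φ)
    (h : ∀ u v, r' u v → r u v ∨ (r u x ∧ r v y) ∨ (r u y ∧ r v x)) :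
    Nat.card (Quotient r) ≤ Nat.card (Quotient r') + 1 := by
  rw [← Finite.card_option]
  refine Nat.card_le_card_of_injective
    (fun q => if q = Quotient.mk r y then none else some (Quotient.mk r' q.out)) ?_
  intro p q hpq
  by_cases hp : p = Quotient.mk r y <;> by_cases hq : q = Quotient.mk r y
  · rw [hp, hq]
  · simp [hp, hq] at hpq
  · simp [hp, hq] at hpq
  · simp only [hp, hq, if_false, Option.some.injEq] at hpq
    rcases h _ _ (Quotient.exact hpq) with h | h | h
    · rw [← Quotient.out_eq p, ← Quotient.out_eq q]
      exact Quotient.sound h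
    · exact absurd (by rw [← Quotient.out_eq q]; exact Quotient.sound h.2) hq
    · exact absurd (by rw [← Quotient.out_eq p]; exact Quotient.sound h.1) hp

theorem merge_equiv {Φ : Type*} (r : Setoid Φ) (x y : Φ) :
    Equivalence (fun u v => r u v ∨ (r u x ∧ r v y) ∨ (r u y ∧ r v x)) := by
  have S : ∀ {a b}, r a b → r b a := fun h => r.symm' h
  have T : ∀ {a b c}, r a b → r b c → r a c := fun h h' => r.trans' h h'
  refine ⟨fun u => Or.inl (r.refl' u), ?_, ?_⟩
  · rintro u v (h | h | h)
    · exact Or.inl (S h)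
    · exact Or.inr (Or.inr ⟨h.2, h.1⟩)
    · exact Or.inr (Or.inl ⟨h.2, h.1⟩)
  · rintro u v w (h | h | h) (k | k | k)
    · exact Or.inl (T h k)
    · exact Or.inr (Or.inl ⟨T h k.1, k.2⟩)
    · exact Or.inr (Or.inr ⟨T h k.1, k.2⟩)
    · exact Or.inr (Or.inl ⟨h.1, T (S k) h.2⟩)
    · exact Or.inr (Or.inl ⟨h.1, k.2⟩)
    · exact Or.inl (T h.1 (S k.2))
    · exact Or.inr (Or.inr ⟨h.1, T (S k) h.2⟩)
    · exact Or.inl (T h.1 (S k.2))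
    · exact Or.inr (Or.inr ⟨h.1, k.2⟩)

def treeRel {Φ : Type*} (s₀ s₁ s₂ : Φ → Φ) (A : Set Φ) : Setoid Φ :=
  Relation.EqvGen.setoid (fun x y => y = s₁ x ∨ y = s₂ x ∨ (x ∈ A ∧ y = s₀ x))

theorem tr_le {Φ : Type*} {s₀ s₁ s₂ : Φ → Φ} {A : Set Φ} {q : Φ → Φ → Prop}
    (hq : Equivalence q) (h1 : ∀ x, q x (s₁ x)) (h2 : ∀ x, q x (s₂ x))
    (h0 : ∀ x ∈ A, q x (s₀ x)) {u v : Φ} (h : treeRel s₀ s₁ s₂ A u v) : q u v := by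
  refine eg_le hq ?_ h
  rintro x y (rfl | rfl | ⟨hx, rfl⟩)
  · exact h1 x
  · exact h2 x
  · exact h0 x hx

theorem tr1 {Φ : Type*} (s₀ s₁ s₂ : Φ → Φ) (A : Set Φ) (x : Φ) :
    treeRel s₀ s₁ s₂ A x (s₁ x) := Relation.EqvGen.rel _ _ (Or.inl rfl)

theorem tr2 {Φ : Type*} (s₀ s₁ s₂ : Φ → Φ) (A : Set Φ) (x : Φ) :
    treeRel s₀ s₁ s₂ A x (s₂ x) := Relation.EqvGen.rel _ _ (Or.inr (Or.inl rfl))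

theorem tr0 {Φ : Type*} (s₀ s₁ s₂ : Φ → Φ) (A : Set Φ) (x : Φ) (hx : x ∈ A) :
    treeRel s₀ s₁ s₂ A x (s₀ x) := Relation.EqvGen.rel _ _ (Or.inr (Or.inr ⟨hx, rfl⟩))

theorem edge_mem {Φ : Type*} (s₀ s₂ : Φ → Φ)
    (h₀ : ∀ x, s₀ (s₀ x) = x) (h₂ : ∀ x, s₂ (s₂ x) = x)
    (hcomm : ∀ x, s₀ (s₂ x) = s₂ (s₀ x)) (x y : Φ) (h : y ∈ genClass s₀ s₂ x) :
    y = x ∨ y = s₀ x ∨ y = s₂ x ∨ y = s₂ (s₀ x) := by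
  refine eg_le (q := fun x y => y = x ∨ y = s₀ x ∨ y = s₂ x ∨ y = s₂ (s₀ x)) ?_ ?_ h
  · refine ⟨fun x => Or.inl rfl, ?_, ?_⟩
    · rintro x y (rfl | rfl | rfl | rfl) <;> simp [h₀, h₂, hcomm]
    · rintro x y z (rfl | rfl | rfl | rfl) (rfl | rfl | rfl | rfl) <;> simp [h₀, h₂, hcomm]
  · rintro x y (h | h) <;> simp [h]

theorem merge_step {Φ : Type*} [Fintype Φ] (s₀ s₁ s₂ : Φ → Φ)
    (h₀ : ∀ x, s₀ (s₀ x) = x) (h₀f : ∀ x, s₀ x ≠ x)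
    (h₁ : ∀ x, s₁ (s₁ x) = x) (h₁f : ∀ x, s₁ x ≠ x)
    (h₂ : ∀ x, s₂ (s₂ x) = x) (h₂f : ∀ x, s₂ x ≠ x)
    (hcomm : ∀ x, s₀ (s₂ x) = s₂ (s₀ x))
    (A : Set Φ) (hA0 : ∀ x ∈ A, s₀ x ∈ A) (hA2 : ∀ x ∈ A, s₂ x ∈ A)
    (x : Φ) (hx : x ∉ A)
    (hold : ∀ u v, treeRel s₀ s₁ s₂ A u v → genRel s₁ (pdMap s₂ s₀ A) u v)
    (hne : ¬ treeRel s₀ s₁ s₂ A x (s₀ x)) :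
    ∀ u v, treeRel s₀ s₁ s₂ (genClass s₀ s₂ x ∪ A) u v →
      genRel s₁ (pdMap s₂ s₀ (genClass s₀ s₂ x ∪ A)) u v := by
  have hx0 : s₀ x ∉ A := fun h => hx (by simpa [h₀] using hA0 _ h)
  have mx : x ∈ genClass s₀ s₂ x := (gr_equiv s₀ s₂).refl x
  have mx2 : s₂ x ∈ genClass s₀ s₂ x := gr_g s₀ s₂ x
  have mem := edge_mem s₀ s₂ h₀ h₂ hcomm x
  set e := genClass s₀ s₂ x with he
  set g := pdMap s₂ s₀ A with hg
  set g' := pdMap s₂ s₀ (e ∪ A) with hg'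
  have gi : ∀ y, g (g y) = y := by
    intro y
    by_cases hy : y ∈ A
    · simp [hg, pdMap, hy, hA0 y hy, h₀]
    · have : s₂ y ∉ A := fun h => hy (by simpa [h₂] using hA2 _ h)
      simp [hg, pdMap, hy, this, h₂]
  have gf : ∀ y, g y ≠ y := by
    intro y
    by_cases hy : y ∈ A
    · simp [hg, pdMap, hy, h₀f]
    · simp [hg, pdMap, hy, h₂f]
  have gle : ∀ u v, genRel s₁ g u v → treeRel s₀ s₁ s₂ A u v := by
    intro u v h
    refine eg_le (treeRel s₀ s₁ s₂ A).iseqv ?_ h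
    rintro u v (rfl | rfl)
    · exact tr1 _ _ _ _ _
    · by_cases hu : u ∈ A
      · simpa [hg, pdMap, hu] using tr0 s₀ s₁ s₂ A u hu
      · simpa [hg, pdMap, hu] using tr2 s₀ s₁ s₂ A u
  have gx : g x = s₂ x := by simp [hg, pdMap, hx]
  have gx0 : g (s₀ x) = s₂ (s₀ x) := by simp [hg, pdMap, hx0]
  have hne' : ¬ genRel s₁ g x (s₀ x) := fun h => hne (gle _ _ h)
  have agree : ∀ y, y ∉ e → g' y = g y := by
    intro y hy; simp [hg, hg', pdMap, hy]
  have Q := gr_equiv s₁ g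
  have Q' := gr_equiv s₁ g'
  have p1 : genRel s₁ g' x (s₂ x) := by
    rw [← gx]
    refine path_aux s₁ g g' h₁ h₁f gi gf x e agree ?_
    intro y hy hr
    rcases mem y hy with rfl | rfl | rfl | rfl
    · exact Or.inl rfl
    · exact absurd hr hne'
    · exact Or.inr gx.symm
    · exact absurd (Q.trans hr (Q.symm (gx0 ▸ gr_g s₁ g (s₀ x)))) hne'
  have p2 : genRel s₁ g' (s₀ x) (s₂ (s₀ x)) := by
    rw [← gx0]
    refine path_aux s₁ g g' h₁ h₁f gi gf (s₀ x) e agree ?_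
    intro y hy hr
    rcases mem y hy with h | h | h | h
    · rw [h] at hr; exact absurd (Q.symm hr) hne'
    · exact Or.inl h
    · rw [h] at hr
      exact absurd (Q.symm (Q.trans hr (Q.symm (gx ▸ gr_g s₁ g x)))) hne'
    · exact Or.inr (h.trans gx0.symm)
  have p3 : genRel s₁ g' x (s₀ x) := by
    have := gr_g s₁ g' x
    simpa [hg', pdMap, mx] using this
  have all : ∀ y ∈ e, genRel s₁ g' x y := by
    intro y hy
    rcases mem y hy with rfl | rfl | rfl | rfl
    · exact Q'.refl _
    · exact p3
    · exact p1
    · exact Q'.trans p3 p2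
  have e0 : ∀ y ∈ e, s₀ y ∈ e := fun y hy => (gr_equiv s₀ s₂).trans hy (gr_f s₀ s₂ y)
  have e2 : ∀ y ∈ e, s₂ y ∈ e := fun y hy => (gr_equiv s₀ s₂).trans hy (gr_g s₀ s₂ y)
  have sub : ∀ u v, genRel s₁ g u v → genRel s₁ g' u v := by
    intro u v h
    refine eg_le Q' ?_ h
    rintro u v (rfl | rfl)
    · exact gr_f _ _ _
    · by_cases hu : u ∈ e
      · refine Q'.trans (Q'.symm (all u hu)) (all _ ?_)
        by_cases hA : u ∈ A
        · simpa [hg, pdMap, hA] using e0 u hu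
        · simpa [hg, pdMap, hA] using e2 u hu
      · rw [← agree u hu]; exact gr_g _ _ _
  intro u v h
  refine tr_le Q' ?_ ?_ ?_ h
  · exact fun y => gr_f _ _ _
  · exact fun y => sub _ _ (hold _ _ (tr2 _ _ _ _ _))
  · rintro y (hy | hy)
    · exact Q'.trans (Q'.symm (all y hy)) (all _ (e0 y hy))
    · exact sub _ _ (hold _ _ (tr0 _ _ _ _ _ hy))

theorem main_ind {Φ : Type*} [Fintype Φ] (s₀ s₁ s₂ : Φ → Φ)
    (h₀ : ∀ x, s₀ (s₀ x) = x) (h₀f : ∀ x, s₀ x ≠ x)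
    (h₁ : ∀ x, s₁ (s₁ x) = x) (h₁f : ∀ x, s₁ x ≠ x)
    (h₂ : ∀ x, s₂ (s₂ x) = x) (h₂f : ∀ x, s₂ x ≠ x)
    (hcomm : ∀ x, s₀ (s₂ x) = s₂ (s₀ x)) (S : Finset (Set Φ)) :
    (∀ C ∈ S, ∃ x, C = genClass s₀ s₂ x) →
    genCount Φ s₁ s₂ ≤ Nat.card (Quotient (treeRel s₀ s₁ s₂ (⋃₀ (S : Set (Set Φ))))) + S.card ∧
    (genCount Φ s₁ s₂ = Nat.card (Quotient (treeRel s₀ s₁ s₂ (⋃₀ (S : Set (Set Φ))))) + S.card →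
      ∀ u v, treeRel s₀ s₁ s₂ (⋃₀ (S : Set (Set Φ))) u v →
        genRel s₁ (pdMap s₂ s₀ (⋃₀ (S : Set (Set Φ)))) u v) := by
  induction S using Finset.induction_on with
  | empty =>
    intro _
    have key : ∀ u v, treeRel s₀ s₁ s₂ (∅ : Set Φ) u v → genRel s₁ s₂ u v := by
      intro u v h
      exact tr_le (gr_equiv s₁ s₂) (gr_f s₁ s₂) (gr_g s₁ s₂) (by simp) h
    simp only [Finset.coe_empty, Set.sUnion_empty, Finset.card_empty, add_zero]
    constructor
    · unfold genCount
      rw [← Nat.card_coe_set_eq]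
      refine Nat.card_le_card_of_injective
        (fun q => Quotient.mk (treeRel s₀ s₁ s₂ (∅ : Set Φ)) q.2.choose) ?_
      intro p q hpq
      have h := key _ _ (Quotient.exact hpq)
      apply Subtype.ext
      rw [← p.2.choose_spec, ← q.2.choose_spec]
      ext z
      exact ⟨fun k => (gr_equiv s₁ s₂).trans ((gr_equiv s₁ s₂).symm h) k,
        fun k => (gr_equiv s₁ s₂).trans h k⟩
    · intro _ u v h
      have : pdMap s₂ s₀ (∅ : Set Φ) = s₂ := by ext; simp [pdMap]
      have hE : ⋃₀ ((∅ : Finset (Set Φ)) : Set (Set Φ)) = ∅ := by simp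
      rw [hE] at h
      rw [this]; exact key u v h
  | insert e S heS ih =>
    intro hS
    obtain ⟨ih1, ih2⟩ := ih (fun C hC => hS C (Finset.mem_insert_of_mem hC))
    obtain ⟨x, rfl⟩ := hS e (Finset.mem_insert_self _ _)
    rw [Finset.coe_insert, Set.sUnion_insert, Finset.card_insert_of_notMem heS]
    have Q := gr_equiv s₀ s₂
    have hA0 : ∀ y ∈ ⋃₀ (S : Set (Set Φ)), s₀ y ∈ ⋃₀ (S : Set (Set Φ)) := by
      rintro y ⟨C, hC, hy⟩
      obtain ⟨z, rfl⟩ := hS C (Finset.mem_insert_of_mem hC)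
      exact ⟨_, hC, Q.trans hy (gr_f _ _ _)⟩
    have hA2 : ∀ y ∈ ⋃₀ (S : Set (Set Φ)), s₂ y ∈ ⋃₀ (S : Set (Set Φ)) := by
      rintro y ⟨C, hC, hy⟩
      obtain ⟨z, rfl⟩ := hS C (Finset.mem_insert_of_mem hC)
      exact ⟨_, hC, Q.trans hy (gr_g _ _ _)⟩
    have hx : x ∉ ⋃₀ (S : Set (Set Φ)) := by
      rintro ⟨C, hC, hy⟩
      obtain ⟨z, rfl⟩ := hS C (Finset.mem_insert_of_mem hC)
      apply heS
      have : genClass s₀ s₂ x = genClass s₀ s₂ z := by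
        ext w
        exact ⟨fun k => Q.trans hy k, fun k => Q.trans (Q.symm hy) k⟩
      rw [this]; exact hC
    have mem := edge_mem s₀ s₂ h₀ h₂ hcomm x
    generalize ⋃₀ (S : Set (Set Φ)) = A at *
    have R := (treeRel s₀ s₁ s₂ A).iseqv
    have t2 := tr2 s₀ s₁ s₂ A
    by_cases hr : treeRel s₀ s₁ s₂ A x (s₀ x)
    · have := count_le (treeRel s₀ s₁ s₂ A) (treeRel s₀ s₁ s₂ (genClass s₀ s₂ x ∪ A)) (by
        intro u v h
        refine tr_le R (tr1 _ _ _ _) (tr2 _ _ _ _) ?_ h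
        rintro y (hy | hy)
        · rcases mem y hy with rfl | rfl | rfl | rfl
          · exact hr
          · rw [h₀]; exact R.symm hr
          · rw [hcomm]; exact R.trans (R.symm (t2 _)) (R.trans hr (t2 _))
          · rw [hcomm, h₀]
            exact R.trans (R.symm (t2 _)) (R.trans (R.symm hr) (t2 _))
        · exact tr0 _ _ _ _ _ hy)
      exact ⟨by omega, fun h => by omega⟩
    · have := count_le_succ (treeRel s₀ s₁ s₂ A) (treeRel s₀ s₁ s₂ (genClass s₀ s₂ x ∪ A))
        x (s₀ x) (by
        intro u v h
        refine tr_le (merge_equiv (treeRel s₀ s₁ s₂ A) x (s₀ x)) (fun y => Or.inl (tr1 _ _ _ _ _))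
          (fun y => Or.inl (tr2 _ _ _ _ _)) ?_ h
        rintro y (hy | hy)
        · rcases mem y hy with rfl | rfl | rfl | rfl
          · exact Or.inr (Or.inl ⟨R.refl _, R.refl _⟩)
          · rw [h₀]; exact Or.inr (Or.inr ⟨R.refl _, R.refl _⟩)
          · rw [hcomm]; exact Or.inr (Or.inl ⟨R.symm (t2 _), R.symm (t2 _)⟩)
          · rw [hcomm, h₀]; exact Or.inr (Or.inr ⟨R.symm (t2 _), R.symm (t2 _)⟩)
        · exact Or.inl (tr0 _ _ _ _ _ hy))
      refine ⟨by omega, fun h => ?_⟩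
      exact merge_step s₀ s₁ s₂ h₀ h₀f h₁ h₁f h₂ h₂f hcomm A hA0 hA2 x hx
        (ih2 (by omega)) hr

/-- If `T` is a union of edges of a connected gem `G` which is a spanning tree (the number
of edges contained in `T` is `V(G) − 1` and the relation generated by `s₁`, `s₂` and by
`s₀` on `T` has a single class), then the partial dual `G^T` has exactly one vertex:
the subgroup generated by `s₁` and `s₂^T` acts transitively on the flags. Hence every
connected ribbon graph has a one-vertex partial dual. -/
theorem pd_spanning_tree_one_vertex (Φ : Type*) [Fintype Φ] [Nonempty Φ]
    (s₀ s₁ s₂ : Equiv.Perm Φ)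
    (h₀ : ∀ x, s₀ (s₀ x) = x) (h₀f : ∀ x, s₀ x ≠ x)
    (h₁ : ∀ x, s₁ (s₁ x) = x) (h₁f : ∀ x, s₁ x ≠ x)
    (h₂ : ∀ x, s₂ (s₂ x) = x) (h₂f : ∀ x, s₂ x ≠ x)
    (hcomm : ∀ x, s₀ (s₂ x) = s₂ (s₀ x)) (h02f : ∀ x, s₀ (s₂ x) ≠ x)
    (T : Set Φ) (hT : ∀ x ∈ T, s₀ x ∈ T ∧ s₂ x ∈ T)
    (hconn : ∀ x y : Φ,
      Relation.EqvGen (fun x y => y = s₀ x ∨ y = s₁ x ∨ y = s₂ x) x y)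
    (hcard : {C : Set Φ | (∃ x, C = genClass (⇑s₀) (⇑s₂) x) ∧ C ⊆ T}.ncard =
      genCount Φ (⇑s₁) (⇑s₂) - 1)
    (hspan : ∀ x y : Φ,
      Relation.EqvGen (fun x y => y = s₁ x ∨ y = s₂ x ∨ (x ∈ T ∧ y = s₀ x)) x y) :
    ∀ x y : Φ, genRel (⇑s₁) (pdMap (⇑s₂) (⇑s₀) T) x y := by

  set F : Set (Set Φ) := {C : Set Φ | (∃ x, C = genClass (⇑s₀) (⇑s₂) x) ∧ C ⊆ T} with hF
  have hU : ⋃₀ ((F.toFinset : Finset (Set Φ)) : Set (Set Φ)) = T := by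
    rw [Set.coe_toFinset]
    ext y
    constructor
    · rintro ⟨C, hC, hy⟩
      exact hC.2 hy
    · intro hy
      refine ⟨genClass s₀ s₂ y, ⟨⟨y, rfl⟩, ?_⟩, (gr_equiv s₀ s₂).refl y⟩
      intro z hz
      rcases edge_mem s₀ s₂ h₀ h₂ hcomm y z hz with rfl | rfl | rfl | rfl
      · exact hy
      · exact (hT _ hy).1
      · exact (hT _ hy).2
      · exact (hT _ (hT _ hy).1).2
  have key := main_ind s₀ s₁ s₂ h₀ h₀f h₁ h₁f h₂ h₂f hcomm F.toFinset
    (by intro C hC; rw [Set.mem_toFinset] at hC; exact hC.1)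
  rw [hU, ← Set.ncard_eq_toFinset_card', hcard] at key
  have hone : Nat.card (Quotient (treeRel s₀ s₁ s₂ T)) = 1 := by
    rw [Nat.card_eq_one_iff_unique]
    refine ⟨⟨?_⟩, ⟨Quotient.mk _ (Classical.arbitrary Φ)⟩⟩
    intro p q
    induction p using Quotient.inductionOn
    induction q using Quotient.inductionOn
    exact Quotient.sound (hspan _ _)
  have hpos : 0 < genCount Φ s₁ s₂ := by
    unfold genCount
    rw [Set.ncard_pos]
    exact Set.range_nonempty _
  rw [hone] at key
  intro x y
  exact key.2 (by omega) x y (hspan x y)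
end
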